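/- There exist absolute constants C > 0 and c > 0 such that for every integer n ≥ 1 and every real x ≥ 1, if H is an n×n GUE random matrix with largest eigenvalue λ_max and second largest eigenvalue λ_2max, then Prob{ |λ_max| < e^{1/x} · |λ_2max| } ≤ C·n⁴/x³ + C·e^{−cn}. -/

import Mathlib

open MeasureTheory ProbabilityTheory Matrix

noncomputable instance matrixMeasurableSpace {m n α : Type*} [MeasurableSpace α] :
    MeasurableSpace (Matrix m n α) := MeasurableSpace.pi

/-- The standard complex Gaussian measure on `ℂ` (independent standard Gaussian
real and imaginary parts). -/
noncomputable def complexGaussian : Measure ℂ :=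
  ((gaussianReal 0 1).prod (gaussianReal 0 1)).map (fun p => Complex.mk p.1 p.2)

/-- The law of an `n × n` matrix with i.i.d. standard complex Gaussian entries. -/
noncomputable def matrixGaussian (n : ℕ) : Measure (Matrix (Fin n) (Fin n) ℂ) :=
  Measure.pi fun _ : Fin n => Measure.pi fun _ : Fin n => complexGaussian

/-- The Gaussian Unitary Ensemble: the law of `H = (G + G*)/2` for `G` complex Gaussian. -/
noncomputable def GUE (n : ℕ) : Measure (Matrix (Fin n) (Fin n) ℂ) :=
  (matrixGaussian n).map (fun G => (1 / 2 : ℂ) • (G + Gᴴ))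

/-- The eigenvalues of a Hermitian matrix, sorted in increasing order
(junk value `0` if the matrix is not Hermitian). -/
noncomputable def sortedEigs {n : ℕ} (H : Matrix (Fin n) (Fin n) ℂ) : Fin n → ℝ :=
  if h : H.IsHermitian then h.eigenvalues ∘ (Tuple.sort h.eigenvalues) else 0

/-- The eigenvalues of a Hermitian matrix, sorted by absolute value in decreasing order,
`|λ₁| ≥ |λ₂| ≥ … ≥ |λₙ|` (junk value `0` if the matrix is not Hermitian);
`absSortedEigs H j` is the eigenvalue of `(j+1)`-largest absolute value. -/
noncomputable def absSortedEigs {n : ℕ} (H : Matrix (Fin n) (Fin n) ℂ) : Fin n → ℝ :=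
  if h : H.IsHermitian then
    fun j => h.eigenvalues ((Tuple.sort fun i => |h.eigenvalues i|) j.rev)
  else 0

section
open scoped ComplexOrder

/-! ### Determinants of block triangular maps -/

lemma det_shear_lower {A B : Type*} [AddCommGroup A] [Module ℝ A] [Module.Finite ℝ A]
    [AddCommGroup B] [Module ℝ B] [Module.Finite ℝ B] (g : A →ₗ[ℝ] B) (L : A × B →ₗ[ℝ] A × B)
    (hL : ∀ p, L p = (p.1, g p.1 + p.2)) : LinearMap.det L = 1 := by
  let b := Module.finBasis ℝ A
  let b' := Module.finBasis ℝ B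
  have : LinearMap.toMatrix (b.prod b') (b.prod b') L
      = Matrix.fromBlocks 1 0 (LinearMap.toMatrix b b' g) 1 := by
    ext i j
    rcases i with i | i <;> rcases j with j | j <;>
      simp [LinearMap.toMatrix_apply, hL, Matrix.one_apply, Finsupp.single_apply, eq_comm]
  rw [← LinearMap.det_toMatrix (b.prod b'), this, Matrix.det_fromBlocks_zero₁₂]
  simp

lemma det_shear_upper {A B : Type*} [AddCommGroup A] [Module ℝ A] [Module.Finite ℝ A]
    [AddCommGroup B] [Module ℝ B] [Module.Finite ℝ B] (g : B →ₗ[ℝ] A) (L : A × B →ₗ[ℝ] A × B)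
    (hL : ∀ p, L p = (p.1 + g p.2, p.2)) : LinearMap.det L = 1 := by
  let b := Module.finBasis ℝ A
  let b' := Module.finBasis ℝ B
  have : LinearMap.toMatrix (b.prod b') (b.prod b') L
      = Matrix.fromBlocks 1 (LinearMap.toMatrix b' b g) 0 1 := by
    ext i j
    rcases i with i | i <;> rcases j with j | j <;>
      simp [LinearMap.toMatrix_apply, hL, Matrix.one_apply, Finsupp.single_apply, eq_comm]
  rw [← LinearMap.det_toMatrix (b.prod b'), this, Matrix.det_fromBlocks_zero₂₁]
  simp

lemma det_lower {A B : Type*} [AddCommGroup A] [Module ℝ A] [Module.Finite ℝ A]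
    [AddCommGroup B] [Module ℝ B] [Module.Finite ℝ B] (f : A →ₗ[ℝ] A) (g : A →ₗ[ℝ] B)
    (h : B →ₗ[ℝ] B) (L : A × B →ₗ[ℝ] A × B)
    (hL : ∀ p, L p = (f p.1, g p.1 + h p.2)) : LinearMap.det L = LinearMap.det f * LinearMap.det h := by
  let S : A × B →ₗ[ℝ] A × B := LinearMap.prod (LinearMap.fst ℝ A B)
    (g ∘ₗ LinearMap.fst ℝ A B + LinearMap.snd ℝ A B)
  have hS : LinearMap.det S = 1 := det_shear_lower g S (fun p => rfl)
  have : L = (LinearMap.prodMap f LinearMap.id) ∘ₗ S ∘ₗ (LinearMap.prodMap LinearMap.id h) := by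
    apply LinearMap.ext; intro p
    rw [hL]; simp [S]
  rw [this, LinearMap.det_comp, LinearMap.det_comp, hS, LinearMap.det_prodMap, LinearMap.det_prodMap]
  simp

lemma det_upper {A B : Type*} [AddCommGroup A] [Module ℝ A] [Module.Finite ℝ A]
    [AddCommGroup B] [Module ℝ B] [Module.Finite ℝ B] (f : A →ₗ[ℝ] A) (g : B →ₗ[ℝ] A)
    (h : B →ₗ[ℝ] B) (L : A × B →ₗ[ℝ] A × B)
    (hL : ∀ p, L p = (f p.1 + g p.2, h p.2)) : LinearMap.det L = LinearMap.det f * LinearMap.det h := by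
  let S : A × B →ₗ[ℝ] A × B := LinearMap.prod (LinearMap.fst ℝ A B + g ∘ₗ LinearMap.snd ℝ A B)
    (LinearMap.snd ℝ A B)
  have hS : LinearMap.det S = 1 := det_shear_upper g S (fun p => rfl)
  have : L = (LinearMap.prodMap LinearMap.id h) ∘ₗ S ∘ₗ (LinearMap.prodMap f LinearMap.id) := by
    apply LinearMap.ext; intro p
    rw [hL]; simp [S]
  rw [this, LinearMap.det_comp, LinearMap.det_comp, hS, LinearMap.det_prodMap, LinearMap.det_prodMap]
  simp [mul_comm]

/-- Real determinant of a complex matrix acting on `ℂ^m`. -/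
lemma det_real_toLin {m : ℕ} (N : Matrix (Fin m) (Fin m) ℂ) :
    LinearMap.det ((Matrix.toLin' N).restrictScalars ℝ) = Complex.normSq N.det := by
  rw [LinearMap.det_restrictScalars, Algebra.norm_complex_apply, LinearMap.det_toLin']

/-- Simultaneous diagonalisation. -/
lemma simul_diag {m : ℕ} (S Y : Matrix (Fin m) (Fin m) ℂ) (hS : S.PosDef) (hY : Y.IsHermitian) :
    ∃ (F : Matrix (Fin m) (Fin m) ℂ) (μ : Fin m → ℝ), IsUnit F ∧
      ∀ t : ℝ, (t : ℂ) • S - Y = Fᴴ * Matrix.diagonal (fun j => ((t - μ j : ℝ) : ℂ)) * F := by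
  obtain ⟨C, hC, hSC⟩ : ∃ C : Matrix (Fin m) (Fin m) ℂ, IsUnit C ∧ S = Cᴴ * C := by
    open scoped MatrixOrder Matrix.Norms.L2Operator in
    obtain ⟨y, hy, h⟩ := CStarAlgebra.isStrictlyPositive_iff_eq_star_mul_self.mp
        hS.isStrictlyPositive
    exact ⟨y, hy, h⟩
  have hCdet : IsUnit C.det := (Matrix.isUnit_iff_isUnit_det _).1 hC
  let A := (C⁻¹)ᴴ * Y * C⁻¹
  have hA : A.IsHermitian := Matrix.isHermitian_conjTranspose_mul_mul _ hY
  have hYA : Y = Cᴴ * A * C := by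
    simp only [A, Matrix.mul_assoc, Matrix.nonsing_inv_mul _ hCdet, Matrix.mul_one]
    rw [← Matrix.mul_assoc, ← Matrix.conjTranspose_mul, Matrix.nonsing_inv_mul _ hCdet]
    simp
  let U : Matrix (Fin m) (Fin m) ℂ := hA.eigenvectorUnitary
  have hU : U * Uᴴ = 1 := Unitary.coe_mul_star_self hA.eigenvectorUnitary
  have hU' : Uᴴ * U = 1 := Unitary.coe_star_mul_self hA.eigenvectorUnitary
  have hsp : A = U * Matrix.diagonal (fun j => (hA.eigenvalues j : ℂ)) * Uᴴ := by
    have := hA.spectral_theorem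
    rw [Unitary.conjStarAlgAut_apply] at this
    exact this
  refine ⟨Uᴴ * C, hA.eigenvalues, ?_, fun t => ?_⟩
  · exact (IsUnit.of_mul_eq_one _ hU').mul hC
  · have hd : Matrix.diagonal (fun j => ((t - hA.eigenvalues j : ℝ) : ℂ))
        = (t : ℂ) • (1 : Matrix (Fin m) (Fin m) ℂ)
          - Matrix.diagonal (fun j => (hA.eigenvalues j : ℂ)) := by
      ext i j
      by_cases h : i = j
      · subst h; simp
      · simp [h]
    rw [hd, Matrix.conjTranspose_mul, Matrix.conjTranspose_conjTranspose]
    have e1 : Cᴴ * U * ((t : ℂ) • (1 : Matrix (Fin m) (Fin m) ℂ)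
          - Matrix.diagonal (fun j => (hA.eigenvalues j : ℂ))) * (Uᴴ * C)
        = (t : ℂ) • (Cᴴ * (U * Uᴴ) * C)
          - Cᴴ * (U * Matrix.diagonal (fun j => (hA.eigenvalues j : ℂ)) * Uᴴ) * C := by
      simp only [Matrix.mul_sub, Matrix.sub_mul, Matrix.mul_smul, Matrix.smul_mul,
        Matrix.mul_assoc, Matrix.mul_one, Matrix.one_mul]
    rw [e1, hU, ← hsp, ← hYA, Matrix.mul_one, ← hSC]

/-- Real quadratic form of a matrix. -/
noncomputable def qf {m : ℕ} (N : Matrix (Fin m) (Fin m) ℂ) (z : Fin m → ℂ) : ℝ :=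
  (star z ⬝ᵥ (N *ᵥ z)).re

/-- Hermitian part. -/
noncomputable def hB {m : ℕ} (Z : Fin m → Fin m → ℂ) : Matrix (Fin m) (Fin m) ℂ :=
  (1 / 2 : ℂ) • (Matrix.of Z + (Matrix.of Z)ᴴ)

lemma hB_isHermitian {m : ℕ} (Z : Fin m → Fin m → ℂ) : (hB Z).IsHermitian := by
  unfold hB Matrix.IsHermitian
  rw [Matrix.conjTranspose_smul, Matrix.conjTranspose_add, Matrix.conjTranspose_conjTranspose,
    add_comm]
  simp

lemma hB_apply {m : ℕ} (Z : Fin m → Fin m → ℂ) (i j : Fin m) :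
    hB Z i j = (1 / 2 : ℂ) * (Z i j + star (Z j i)) := by
  simp [hB]

lemma herm_swap {m : ℕ} {N : Matrix (Fin m) (Fin m) ℂ} (hN : N.IsHermitian) (a b : Fin m → ℂ) :
    star (star a ⬝ᵥ (N *ᵥ b)) = star b ⬝ᵥ (N *ᵥ a) := by
  rw [Matrix.star_dotProduct, star_star, dotProduct_comm, Matrix.star_mulVec, hN.eq, dotProduct_comm,
    ← Matrix.dotProduct_mulVec]

lemma herm_swap_re {m : ℕ} {N : Matrix (Fin m) (Fin m) ℂ} (hN : N.IsHermitian) (a b : Fin m → ℂ) :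
    (star a ⬝ᵥ (N *ᵥ b)).re = (star b ⬝ᵥ (N *ᵥ a)).re := by
  rw [← herm_swap hN]; simp

lemma re_star_dot_self {m : ℕ} (w : Fin m → ℂ) : star w ⬝ᵥ w = ((∑ i, ‖w i‖ ^ 2 : ℝ) : ℂ) := by
  simp only [dotProduct, Pi.star_apply, RCLike.star_def, Complex.conj_mul']
  push_cast; rfl

abbrev FF (m : ℕ) := (Fin m → Fin m → ℂ) × (ℝ × (Fin m → ℂ))
abbrev EE (m : ℕ) := ℝ × ((Fin m → ℂ) × FF m)

noncomputable def Nm {m : ℕ} (p : EE m) : Matrix (Fin m) (Fin m) ℂ :=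
  (p.1 : ℂ) • (1 : Matrix (Fin m) (Fin m) ℂ) - hB p.2.2.1

lemma Nm_isHermitian {m : ℕ} (p : EE m) : (Nm p).IsHermitian := by
  unfold Nm
  apply Matrix.IsHermitian.sub _ (hB_isHermitian _)
  unfold Matrix.IsHermitian
  rw [Matrix.conjTranspose_smul]; simp

noncomputable def Psi {m : ℕ} (p : EE m) : EE m :=
  (p.1 - qf (Nm p) p.2.1, (Nm p *ᵥ p.2.1, p.2.2))

/-- entry of `Nm` as a linear map -/
noncomputable def NmL {m : ℕ} (i j : Fin m) : EE m →ₗ[ℝ] ℂ where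
  toFun p := Nm p i j
  map_add' p q := by
    simp [Nm, hB_apply]; ring
  map_smul' c p := by
    simp [Nm, hB_apply]; ring

noncomputable def wL {m : ℕ} (i : Fin m) : EE m →ₗ[ℝ] ℂ where
  toFun p := p.2.1 i
  map_add' p q := by simp
  map_smul' c p := by simp

lemma hasFDerivAt_comp2 {m : ℕ} (p : EE m) (i : Fin m) :
    HasFDerivAt (fun p : EE m => ∑ j, Nm p i j * p.2.1 j)
      (∑ j, ((NmL i j p) • (wL j).toContinuousLinearMap
        + (wL j p) • (NmL i j).toContinuousLinearMap)) p := by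
  refine HasFDerivAt.fun_sum (fun j _ => ?_)
  exact (NmL i j).toContinuousLinearMap.hasFDerivAt.mul (wL j).toContinuousLinearMap.hasFDerivAt

noncomputable def DPsi {m : ℕ} (p : EE m) : EE m →ₗ[ℝ] EE m where
  toFun v := (v.1 * (1 - ∑ i, ‖p.2.1 i‖ ^ 2) - 2 * (star p.2.1 ⬝ᵥ (Nm p *ᵥ v.2.1)).re
      + qf (hB v.2.2.1) p.2.1,
    (Nm p *ᵥ v.2.1 + (v.1 : ℂ) • p.2.1 - hB v.2.2.1 *ᵥ p.2.1, v.2.2))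
  map_add' := by
    have hadd : ∀ a b : Fin m → Fin m → ℂ, hB (a + b) = hB a + hB b := by
      intro a b; ext i j; simp [hB_apply]; ring
    intro v u
    ext1
    · simp [qf, hadd, Matrix.mulVec_add, Matrix.add_mulVec, add_mul]; ring
    · ext1
      · simp [hadd, Matrix.mulVec_add, Matrix.add_mulVec, add_smul]; abel
      · simp
  map_smul' := by
    have hsm : ∀ (c : ℝ) (b : Fin m → Fin m → ℂ), hB (c • b) = (c : ℂ) • hB b := by
      intro a b; ext i j; simp [hB_apply]; ring
    intro c v
    have h1 : Nm p *ᵥ (c • v.2.1) = (c : ℂ) • (Nm p *ᵥ v.2.1) := by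
      rw [← Matrix.mulVec_smul]; rfl
    ext1
    · simp [qf, hsm, h1, Matrix.smul_mulVec]; ring
    · ext1
      · simp only [Prod.smul_fst, Prod.smul_snd, hsm, h1, Matrix.smul_mulVec]
        ext i
        simp; ring
      · simp

lemma hasFDerivAt_Psi {m : ℕ} (p : EE m) :
    HasFDerivAt Psi (DPsi p).toContinuousLinearMap p := by
  have hN : ∀ (p : EE m) (i : Fin m), (Nm p *ᵥ p.2.1) i = ∑ j, Nm p i j * p.2.1 j := fun p i => rfl
  have hq : ∀ p : EE m, qf (Nm p) p.2.1
      = Complex.reCLM (∑ i, (starRingEnd ℂ) (p.2.1 i) * ∑ j, Nm p i j * p.2.1 j) := by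
    intro p; simp [qf, dotProduct, hN]
  have h1 : HasFDerivAt (fun p : EE m => qf (Nm p) p.2.1)
      (Complex.reCLM ∘L (∑ i, ((starRingEnd ℂ) (p.2.1 i) • (∑ j, ((NmL i j p) • (wL j).toContinuousLinearMap
        + (wL j p) • (NmL i j).toContinuousLinearMap)) + (∑ j, Nm p i j * p.2.1 j) •
          ((Complex.conjCLE : ℂ →L[ℝ] ℂ) ∘L (wL i).toContinuousLinearMap)))) p := by
    simp_rw [hq]
    refine Complex.reCLM.hasFDerivAt.comp p (HasFDerivAt.fun_sum (fun i _ => ?_))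
    refine HasFDerivAt.mul ?_ (hasFDerivAt_comp2 p i)
    exact ((Complex.conjCLE : ℂ →L[ℝ] ℂ) ∘L (wL i).toContinuousLinearMap).hasFDerivAt
  have h2 : HasFDerivAt (fun p : EE m => Nm p *ᵥ p.2.1)
      (ContinuousLinearMap.pi (fun i => (∑ j, ((NmL i j p) • (wL j).toContinuousLinearMap
        + (wL j p) • (NmL i j).toContinuousLinearMap)))) p := by
    rw [hasFDerivAt_pi]
    exact fun i => hasFDerivAt_comp2 p i
  have h3 := (((ContinuousLinearMap.fst ℝ ℝ ((Fin m → ℂ) × FF m)).hasFDerivAt (x := p)).sub h1).prodMk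
    (h2.prodMk (((ContinuousLinearMap.snd ℝ (Fin m → ℂ) (FF m)) ∘L
      (ContinuousLinearMap.snd ℝ ℝ ((Fin m → ℂ) × FF m))).hasFDerivAt (x := p)))
  refine h3.congr_fderiv ?_
  have hNv : ∀ (v : EE m) (i j : Fin m), NmL i j v = (v.1 : ℂ) * (1 : Matrix (Fin m) (Fin m) ℂ) i j
      - hB v.2.2.1 i j := fun v i j => by simp [NmL, Nm]
  have key : ∀ (v : EE m) (i : Fin m), ∑ j, ((NmL i j p) * v.2.1 j + (p.2.1 j) * (NmL i j v))
      = (Nm p *ᵥ v.2.1 + (v.1 : ℂ) • p.2.1 - hB v.2.2.1 *ᵥ p.2.1) i := by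
    intro v i
    simp only [hNv v, Pi.sub_apply, Pi.add_apply, Matrix.mulVec, dotProduct, Pi.smul_apply, smul_eq_mul]
    rw [Finset.sum_add_distrib, add_sub_assoc]
    congr 1
    simp only [mul_sub, Finset.sum_sub_distrib]
    simp [Matrix.one_apply, mul_comm]
  refine ContinuousLinearMap.ext (fun v => ?_)
  have e2 : (fun i => ∑ j, ((NmL i j p) * v.2.1 j + (p.2.1 j) * (NmL i j v)))
     = (Nm p *ᵥ v.2.1 + (v.1 : ℂ) • p.2.1 - hB v.2.2.1 *ᵥ p.2.1) := funext (key v)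
  ext1
  · change v.1 - Complex.re _ = v.1 * (1 - ∑ i, ‖p.2.1 i‖ ^ 2)
      - 2 * (star p.2.1 ⬝ᵥ (Nm p *ᵥ v.2.1)).re + qf (hB v.2.2.1) p.2.1
    have e3 : (∑ i, ((starRingEnd ℂ) (p.2.1 i) • (∑ j, ((NmL i j p) • (wL j).toContinuousLinearMap
        + (wL j p) • (NmL i j).toContinuousLinearMap)) + (∑ j, Nm p i j * p.2.1 j) •
          ((Complex.conjCLE : ℂ →L[ℝ] ℂ) ∘L (wL i).toContinuousLinearMap))) v
        = star p.2.1 ⬝ᵥ (Nm p *ᵥ v.2.1 + (v.1 : ℂ) • p.2.1 - hB v.2.2.1 *ᵥ p.2.1)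
          + star v.2.1 ⬝ᵥ (Nm p *ᵥ p.2.1) := by
      rw [← e2]
      simp only [_root_.sum_apply, dotProduct, ← Finset.sum_add_distrib]
      refine Finset.sum_congr rfl (fun i _ => ?_)
      simp [hN, wL, Finset.mul_sum, mul_comm]
    refine Eq.trans (congrArg (fun z : ℂ => v.1 - z.re) e3) ?_
    beta_reduce
    rw [dotProduct_sub, dotProduct_add, dotProduct_smul, re_star_dot_self]
    have e4 := herm_swap_re (Nm_isHermitian p) v.2.1 p.2.1
    simp only [Complex.add_re, Complex.sub_re, smul_eq_mul, e4, qf, Complex.re_ofReal_mul,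
      Complex.ofReal_re]
    ring
  · ext1
    · change _ = Nm p *ᵥ v.2.1 + (v.1 : ℂ) • p.2.1 - hB v.2.2.1 *ᵥ p.2.1
      rw [← e2]
      ext i
      simp [wL]
    · rfl

lemma det_DPsi {m : ℕ} (p : EE m) :
    (DPsi p).toContinuousLinearMap.det
      = (1 + ∑ i, ‖p.2.1 i‖ ^ 2) * Complex.normSq (Nm p).det := by
  have hdet : (DPsi p).toContinuousLinearMap.det = LinearMap.det (DPsi p) := by
    simp [ContinuousLinearMap.det]
  rw [hdet]
  set κ : ℝ := 1 + ∑ i, ‖p.2.1 i‖ ^ 2 with hκ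
  have hκ0 : 0 < κ := by
    have : 0 ≤ ∑ i, ‖p.2.1 i‖ ^ 2 := Finset.sum_nonneg (fun i _ => by positivity)
    linarith
  have hadd : ∀ a b : Fin m → Fin m → ℂ, hB (a + b) = hB a + hB b := by
    intro a b; ext i j; simp [hB_apply]; ring
  have hsm : ∀ (c : ℝ) (b : Fin m → Fin m → ℂ), hB (c • b) = (c : ℂ) • hB b := by
    intro a b; ext i j; simp [hB_apply]; ring
  let g1 : ((Fin m → ℂ) × FF m) →ₗ[ℝ] ℝ :=
    { toFun := fun u => 2 * (star p.2.1 ⬝ᵥ u.1).re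
      map_add' := fun u v => by simp [dotProduct_add]; ring
      map_smul' := fun c u => by
        simp only [Prod.smul_fst, dotProduct_smul]
        simp; ring }
  let g2 : ((Fin m → ℂ) × FF m) →ₗ[ℝ] ℝ :=
    { toFun := fun u => qf (hB u.2.1) p.2.1 / κ
      map_add' := fun u v => by
        simp [qf, hadd, dotProduct_add, Matrix.add_mulVec]; ring
      map_smul' := fun c u => by
        simp [qf, hsm, Matrix.smul_mulVec, dotProduct_smul]; ring }
  let S1 : EE m →ₗ[ℝ] EE m := LinearMap.prod (LinearMap.fst ℝ _ _ + g1 ∘ₗ LinearMap.snd ℝ _ _)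
    (LinearMap.snd ℝ _ _)
  have hS1 : LinearMap.det S1 = 1 := det_shear_upper g1 S1 (fun _ => rfl)
  let S2 : EE m →ₗ[ℝ] EE m := LinearMap.prod (LinearMap.fst ℝ _ _ + g2 ∘ₗ LinearMap.snd ℝ _ _)
    (LinearMap.snd ℝ _ _)
  have hS2 : LinearMap.det S2 = 1 := det_shear_upper g2 S2 (fun _ => rfl)
  let g3 : FF m →ₗ[ℝ] (Fin m → ℂ) :=
    { toFun := fun u => ((qf (hB u.1) p.2.1 / κ : ℝ) : ℂ) • p.2.1 - hB u.1 *ᵥ p.2.1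
      map_add' := fun u v => by
        ext i
        simp [qf, hadd, dotProduct_add, Matrix.add_mulVec]; ring
      map_smul' := fun c u => by
        ext i
        simp [qf, hsm, Matrix.smul_mulVec, dotProduct_smul]; ring }
  let g4 : ℝ →ₗ[ℝ] ((Fin m → ℂ) × FF m) :=
    { toFun := fun t => ((t : ℂ) • p.2.1, 0)
      map_add' := fun u v => by ext1 <;> simp [add_smul]
      map_smul' := fun c u => by ext1 <;> simp [mul_smul] }
  let h : ((Fin m → ℂ) × FF m) →ₗ[ℝ] ((Fin m → ℂ) × FF m) := LinearMap.prod
    (((Matrix.toLin' (Nm p)).restrictScalars ℝ) ∘ₗ LinearMap.fst ℝ _ _ + g3 ∘ₗ LinearMap.snd ℝ _ _)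
    (LinearMap.snd ℝ _ _)
  have hh : LinearMap.det h = Complex.normSq (Nm p).det := by
    rw [det_upper ((Matrix.toLin' (Nm p)).restrictScalars ℝ) g3 LinearMap.id h (fun _ => rfl),
      det_real_toLin, LinearMap.det_id, mul_one]
  have hT : LinearMap.det (S1 ∘ₗ DPsi p ∘ₗ S2) = κ * Complex.normSq (Nm p).det := by
    rw [det_lower (κ • (LinearMap.id : ℝ →ₗ[ℝ] ℝ)) g4 h _, hh]
    · simp
    · intro v
      have hS2v : S2 v = (v.1 + qf (hB v.2.2.1) p.2.1 / κ, v.2) := rfl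
      rw [LinearMap.comp_apply, LinearMap.comp_apply, hS2v]
      ext1
      · change ((v.1 + qf (hB v.2.2.1) p.2.1 / κ) * (1 - ∑ i, ‖p.2.1 i‖ ^ 2)
            - 2 * (star p.2.1 ⬝ᵥ (Nm p *ᵥ v.2.1)).re + qf (hB v.2.2.1) p.2.1)
            + 2 * (star p.2.1 ⬝ᵥ (Nm p *ᵥ v.2.1
              + ((v.1 + qf (hB v.2.2.1) p.2.1 / κ : ℝ) : ℂ) • p.2.1 - hB v.2.2.1 *ᵥ p.2.1)).re
            = κ * v.1
        rw [dotProduct_sub, dotProduct_add, dotProduct_smul, re_star_dot_self]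
        simp only [Complex.add_re, Complex.sub_re, smul_eq_mul, Complex.re_ofReal_mul,
          Complex.ofReal_re]
        have : (star p.2.1 ⬝ᵥ hB v.2.2.1 *ᵥ p.2.1).re = qf (hB v.2.2.1) p.2.1 := rfl
        rw [this]
        have h5 : ∑ i, ‖p.2.1 i‖ ^ 2 = κ - 1 := by rw [hκ]; ring
        rw [h5]
        field_simp
        ring
      · ext1
        · change Nm p *ᵥ v.2.1
              + ((v.1 + qf (hB v.2.2.1) p.2.1 / κ : ℝ) : ℂ) • p.2.1 - hB v.2.2.1 *ᵥ p.2.1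
              = (v.1 : ℂ) • p.2.1 + (Nm p *ᵥ v.2.1 +
              (((qf (hB v.2.2.1) p.2.1 / κ : ℝ) : ℂ) • p.2.1 - hB v.2.2.1 *ᵥ p.2.1))
          rw [Complex.ofReal_add, add_smul]
          abel
        · change v.2.2 = 0 + v.2.2
          simp
  rw [LinearMap.det_comp, LinearMap.det_comp, hS1, hS2] at hT
  simpa using hT

lemma lintegral_affine (F : ℝ → ENNReal) (a s : ℝ) (hs : 0 < s) :
    ∫⁻ t, F t = ENNReal.ofReal s * ∫⁻ u, F (a + s * u) := by
  have h := lintegral_image_eq_lintegral_abs_deriv_mul (s := Set.univ) (f := fun u => a + s * u)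
    (f' := fun _ => s) MeasurableSet.univ
    (fun u _ => by
      have := ((hasDerivAt_id u).const_mul s).const_add a
      simp only [mul_one, id] at this
      exact this.hasDerivWithinAt)
    (fun u _ v _ huv => by
      have : s * u = s * v := by simpa using huv
      exact mul_left_cancel₀ hs.ne' this) F
  have himg : (fun u => a + s * u) '' Set.univ = Set.univ := by
    rw [Set.image_univ, Set.range_eq_univ]
    intro y
    exact ⟨(y - a) / s, by field_simp; ring⟩
  rw [himg] at h
  simp only [Measure.restrict_univ, abs_of_pos hs] at h
  rw [h, lintegral_const_mul' _ _ (by simp)]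

lemma oneD (a L δ : ℝ) (r : ℝ → ℝ) (hL : 1 ≤ L) (hδ : 0 < δ) (hδL : δ * L ≤ 1)
    (hr0 : ∀ t, a < t → 0 ≤ r t) (hmono : ∀ t u, a < t → t ≤ u → r t ≤ r u) :
    ∫⁻ t in {t | a < t ∧ t ≤ a + δ ∧ |t| ≤ L},
        ENNReal.ofReal (((t - a) ^ 2 * r t) * Real.exp (-(t ^ 2) / 2))
      ≤ ENNReal.ofReal (Real.exp (3 / 2) * (δ * L) ^ 3) *
        ∫⁻ t in Set.Ioi a, ENNReal.ofReal (((t - a) ^ 2 * r t) * Real.exp (-(t ^ 2) / 2)) := by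
  have hL0 : 0 < L := by linarith
  set s := δ * L with hs
  have hs0 : 0 < s := by positivity
  have hA : MeasurableSet {t : ℝ | a < t ∧ t ≤ a + δ ∧ |t| ≤ L} := by
    apply MeasurableSet.inter measurableSet_Ioi
    apply MeasurableSet.inter measurableSet_Iic
    exact measurableSet_le continuous_abs.measurable measurable_const
  rw [← lintegral_indicator hA, ← lintegral_indicator measurableSet_Ioi]
  conv_lhs => rw [lintegral_affine _ a s hs0]
  conv_rhs => rw [lintegral_affine _ a 1 one_pos]
  simp only [one_mul, ENNReal.ofReal_one]
  have e : ENNReal.ofReal (Real.exp (3 / 2) * s ^ 3)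
      = ENNReal.ofReal s * ENNReal.ofReal (Real.exp (3 / 2) * s ^ 2) := by
    rw [← ENNReal.ofReal_mul hs0.le]; congr 1; ring
  rw [e, mul_assoc]
  gcongr
  rw [← lintegral_const_mul' _ _ (by simp)]
  refine lintegral_mono (fun u => ?_)
  by_cases hu : a + s * u ∈ {t : ℝ | a < t ∧ t ≤ a + δ ∧ |t| ≤ L}
  swap
  · simp [Set.indicator_of_notMem hu]
  rw [Set.indicator_of_mem hu]
  obtain ⟨h1, h2, h3⟩ := hu
  have hu0 : 0 < u := by
    by_contra h; push Not at h
    nlinarith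
  have hu1 : u * L ≤ 1 := by
    have : s * u ≤ δ := by linarith
    rw [hs] at this
    by_contra h; push Not at h
    nlinarith
  rw [Set.indicator_of_mem (by simpa using hu0)]
  rw [← ENNReal.ofReal_mul (by positivity)]
  apply ENNReal.ofReal_le_ofReal
  have hr1 : r (a + s * u) ≤ r (a + u) := hmono _ _ h1 (by nlinarith)
  have hr2 := hr0 _ h1
  have hexp : Real.exp (-((a + s * u) ^ 2) / 2) ≤ Real.exp (3 / 2) * Real.exp (-((a + u) ^ 2) / 2) := by
    rw [← Real.exp_add]
    apply Real.exp_le_exp.2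
    have h4 : (a + u) ^ 2 - (a + s * u) ^ 2 = ((1 - s) * u) * (2 * (a + s * u) + (1 - s) * u) := by ring
    have h5 : a + s * u ≤ L := (abs_le.1 h3).2
    have h6 : 0 ≤ (1 - s) * u := by nlinarith
    have h7 : (1 - s) * u ≤ u := by nlinarith
    have h8 : u ≤ 1 := by nlinarith
    have h9 : ((1 - s) * u) * (2 * (a + s * u) + (1 - s) * u) ≤ ((1 - s) * u) * (2 * L + 1) := by
      apply mul_le_mul_of_nonneg_left _ h6; linarith
    have h10 : ((1 - s) * u) * (2 * L + 1) ≤ u * (2 * L + 1) := by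
      apply mul_le_mul_of_nonneg_right h7; linarith
    nlinarith
  calc (a + s * u - a) ^ 2 * r (a + s * u) * Real.exp (-(a + s * u) ^ 2 / 2)
      ≤ (a + s * u - a) ^ 2 * r (a + u) * (Real.exp (3 / 2) * Real.exp (-((a + u) ^ 2) / 2)) := by
        gcongr
        exact mul_nonneg (sq_nonneg _) (hr2.trans hr1)
    _ = _ := by ring

/-- the rank one matrix `w w^* / κ` -/
noncomputable def Rw {m : ℕ} (w : Fin m → ℂ) : Fin m → Fin m → ℂ :=
  fun i j => w i * star (w j) / ((1 + ∑ i, ‖w i‖ ^ 2 : ℝ) : ℂ)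

noncomputable def Sw {m : ℕ} (w : Fin m → ℂ) : Matrix (Fin m) (Fin m) ℂ := 1 - Matrix.of (Rw w)

lemma Rw_symm {m : ℕ} (w : Fin m → ℂ) (i j : Fin m) : star (Rw w i j) = Rw w j i := by
  simp only [Rw, star_div₀, star_mul', star_star]
  rw [mul_comm]; simp

lemma hB_add {m : ℕ} (a b : Fin m → Fin m → ℂ) : hB (a + b) = hB a + hB b := by
  ext i j; simp [hB_apply]; ring

lemma hB_smul {m : ℕ} (c : ℝ) (b : Fin m → Fin m → ℂ) : hB (c • b) = (c : ℂ) • hB b := by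
  ext i j; simp [hB_apply]; ring

lemma hB_Rw {m : ℕ} (w : Fin m → ℂ) : hB (Rw w) = Matrix.of (Rw w) := by
  ext i j; rw [hB_apply, Rw_symm]; simp; ring

lemma kap_pos {m : ℕ} (w : Fin m → ℂ) : 0 < 1 + ∑ i, ‖w i‖ ^ 2 := by
  have : 0 ≤ ∑ i, ‖w i‖ ^ 2 := Finset.sum_nonneg (fun i _ => by positivity)
  linarith

lemma Rw_mulVec {m : ℕ} (w z : Fin m → ℂ) : Matrix.of (Rw w) *ᵥ z =
    ((star w ⬝ᵥ z) / ((1 + ∑ i, ‖w i‖ ^ 2 : ℝ) : ℂ)) • w := by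
  ext i
  simp only [Matrix.mulVec, dotProduct, Matrix.of_apply, Rw, Pi.smul_apply, smul_eq_mul,
    Finset.sum_div, Finset.sum_mul, Pi.star_apply]
  refine Finset.sum_congr rfl (fun j _ => ?_)
  ring

lemma Sw_isHermitian {m : ℕ} (w : Fin m → ℂ) : (Sw w).IsHermitian := by
  ext i j
  simp only [Sw, conjTranspose_apply, Matrix.sub_apply, Matrix.of_apply, star_sub, Rw_symm]
  congr 1
  simp [Matrix.one_apply, eq_comm]

lemma Sw_mulVec_self {m : ℕ} (w : Fin m → ℂ) :
    Sw w *ᵥ w = (1 / ((1 + ∑ i, ‖w i‖ ^ 2 : ℝ) : ℂ)) • w := by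
  have h := kap_pos w
  have h' : ((1 + ∑ i, ‖w i‖ ^ 2 : ℝ) : ℂ) ≠ 0 := by exact_mod_cast h.ne'
  rw [Sw, Matrix.sub_mulVec, Rw_mulVec, re_star_dot_self, Matrix.one_mulVec]
  ext i
  simp only [Pi.sub_apply, Pi.smul_apply, smul_eq_mul]
  field_simp
  push_cast
  ring

lemma Sw_posDef {m : ℕ} (w : Fin m → ℂ) : (Sw w).PosDef := by
  refine Matrix.PosDef.of_dotProduct_mulVec_pos (Sw_isHermitian w) (fun z hz => ?_)
  have hκ := kap_pos w
  have h : star z ⬝ᵥ (Sw w *ᵥ z) = (((∑ i, ‖z i‖ ^ 2) - ‖star w ⬝ᵥ z‖ ^ 2 / (1 + ∑ i, ‖w i‖ ^ 2) : ℝ) : ℂ) := by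
    rw [Sw, Matrix.sub_mulVec, Rw_mulVec, Matrix.one_mulVec, dotProduct_sub, dotProduct_smul,
      re_star_dot_self]
    have : star z ⬝ᵥ w = star (star w ⬝ᵥ z) := by
      rw [Matrix.star_dotProduct]
    rw [this, smul_eq_mul, Complex.ofReal_sub, Complex.ofReal_div]
    congr 1
    rw [RCLike.star_def, div_mul_eq_mul_div, Complex.mul_conj']
    push_cast; rfl
  rw [h]
  have hz2 : 0 < ∑ i, ‖z i‖ ^ 2 := by
    obtain ⟨i, hi⟩ := Function.ne_iff.1 hz
    refine Finset.sum_pos' (fun i _ => by positivity) ⟨i, Finset.mem_univ _, ?_⟩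
    have : 0 < ‖z i‖ := norm_pos_iff.2 hi
    positivity
  have hcs : ‖star w ⬝ᵥ z‖ ^ 2 ≤ (∑ i, ‖w i‖ ^ 2) * ∑ i, ‖z i‖ ^ 2 := by
    have h1 : ‖star w ⬝ᵥ z‖ ≤ ∑ i, ‖w i‖ * ‖z i‖ := by
      refine (norm_sum_le _ _).trans (le_of_eq ?_)
      refine Finset.sum_congr rfl (fun i _ => ?_)
      simp
    calc _ ≤ (∑ i, ‖w i‖ * ‖z i‖) ^ 2 := by gcongr
      _ ≤ _ := Finset.sum_mul_sq_le_sq_mul_sq _ _ _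
  have : 0 < (∑ i, ‖z i‖ ^ 2) - ‖star w ⬝ᵥ z‖ ^ 2 / (1 + ∑ i, ‖w i‖ ^ 2) := by
    rw [sub_pos, div_lt_iff₀ hκ]
    nlinarith
  exact_mod_cast this

lemma posDef_congr_diag {m : ℕ} {F : Matrix (Fin m) (Fin m) ℂ} (hF : IsUnit F) (d : Fin m → ℝ) :
    (Fᴴ * diagonal (fun j => ((d j : ℝ) : ℂ)) * F).PosDef ↔ ∀ j, 0 < d j := by
  rw [← Matrix.star_eq_conjTranspose, Matrix.IsUnit.posDef_star_left_conjugate_iff hF]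
  rw [Matrix.posDef_diagonal_iff]
  simp

noncomputable def fib {m : ℕ} (q : (Fin m → ℂ) × FF m) (t : ℝ) : EE m :=
  (t, (q.1, (q.2.1 + t • Rw q.1, q.2.2)))

lemma Nm_fib {m : ℕ} (q : (Fin m → ℂ) × FF m) (t : ℝ) :
    Nm (fib q t) = (t : ℂ) • Sw q.1 - hB q.2.1 := by
  simp only [Nm, fib, hB_add, hB_smul, hB_Rw, Sw, smul_sub]
  abel

noncomputable def Qf {m : ℕ} (v : EE m) : ℝ :=
  v.1 ^ 2 + 2 * ∑ i, ‖v.2.1 i‖ ^ 2 + ∑ i, ∑ j, ‖v.2.2.1 i j‖ ^ 2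
    + (v.2.2.2.1 ^ 2 + 2 * ∑ i, ‖v.2.2.2.2 i‖ ^ 2)

noncomputable def Jac {m : ℕ} (p : EE m) : ℝ :=
  ((1 + ∑ i, ‖p.2.1 i‖ ^ 2) * Complex.normSq (Nm p).det) * Real.exp (-(Qf (Psi p)) / 2)

lemma norm_sq_add_smul (a b : ℂ) (t : ℝ) :
    ‖a + t • b‖ ^ 2 = ‖a‖ ^ 2 + 2 * t * (star a * b).re + t ^ 2 * ‖b‖ ^ 2 := by
  simp only [← Complex.normSq_eq_norm_sq, Complex.normSq_apply]
  simp
  ring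

lemma sum_star_mul_Rw {m : ℕ} (Y : Fin m → Fin m → ℂ) (w : Fin m → ℂ) :
    ∑ i, ∑ j, (star (Y i j) * Rw w i j).re = qf (hB Y) w / (1 + ∑ i, ‖w i‖ ^ 2) := by
  have h1 : ∀ i j, (star (Y i j) * Rw w i j).re
      = (star (w i) * (Y i j * w j)).re / (1 + ∑ i, ‖w i‖ ^ 2) := by
    intro i j
    rw [Rw, mul_div_assoc', Complex.div_ofReal_re]
    congr 1
    simp; ring
  have h2 : qf (hB Y) w = ∑ i, ∑ j, (star (w i) * (Y i j * w j)).re := by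
    have : qf (hB Y) w = ∑ i, ∑ j, (1/2) * ((star (w i) * (Y i j * w j)).re
        + (star (w j) * (Y j i * w i)).re) := by
      simp only [qf, dotProduct, Matrix.mulVec, Complex.re_sum, Finset.mul_sum, hB_apply]
      refine Finset.sum_congr rfl (fun i _ => Finset.sum_congr rfl (fun j _ => ?_))
      simp; ring
    rw [this]
    simp only [← Finset.mul_sum, Finset.sum_add_distrib]
    rw [Finset.sum_comm (f := fun i j => (star (w j) * (Y j i * w i)).re)]
    ring
  rw [h2]
  simp only [h1, Finset.sum_div]

lemma sum_norm_Rw {m : ℕ} (w : Fin m → ℂ) :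
    ∑ i, ∑ j, ‖Rw w i j‖ ^ 2 = (∑ i, ‖w i‖ ^ 2) ^ 2 / (1 + ∑ i, ‖w i‖ ^ 2) ^ 2 := by
  have hκ := kap_pos w
  have h : ∀ i j, ‖Rw w i j‖ ^ 2 = ‖w i‖ ^ 2 * ‖w j‖ ^ 2 / (1 + ∑ i, ‖w i‖ ^ 2) ^ 2 := by
    intro i j
    rw [Rw, norm_div, norm_mul, norm_star, Complex.norm_real, Real.norm_of_nonneg hκ.le, div_pow,
      mul_pow]
  simp only [h, ← Finset.sum_div]
  congr 1
  rw [sq, Finset.sum_mul_sum]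

lemma Qf_fib {m : ℕ} (q : (Fin m → ℂ) × FF m) (t : ℝ) :
    Qf (Psi (fib q t)) = t ^ 2 + Qf (Psi (fib q 0)) := by
  obtain ⟨w, Y, b, y⟩ := q
  have hκ := kap_pos w
  set κ := 1 + ∑ i, ‖w i‖ ^ 2 with hκd
  have hs : ∑ i, ‖w i‖ ^ 2 = κ - 1 := by rw [hκd]; ring
  set h := hB Y *ᵥ w with hh
  have hNw : ∀ t : ℝ, Nm (fib (w, Y, b, y) t) *ᵥ w = -h + (t / κ) • w := by
    intro t
    rw [Nm_fib, Matrix.sub_mulVec, Matrix.smul_mulVec, Sw_mulVec_self]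
    ext i
    simp [← hh, hκd]
    ring
  have hqw : qf (hB Y) w = (star w ⬝ᵥ h).re := rfl
  have hq : ∀ t : ℝ, qf (Nm (fib (w, Y, b, y) t)) w = -(qf (hB Y) w) + t / κ * (κ - 1) := by
    intro t
    rw [qf, hNw, dotProduct_add, dotProduct_neg, dotProduct_smul, re_star_dot_self, hqw, hs]
    simp
  have hsum : ∀ t : ℝ, ∑ i, ‖(-h + (t / κ) • w) i‖ ^ 2
      = ∑ i, ‖h i‖ ^ 2 - 2 * (t / κ) * qf (hB Y) w + (t / κ) ^ 2 * (κ - 1) := by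
    intro t
    have : qf (hB Y) w = ∑ i, (star (h i) * w i).re := by
      rw [hqw, dotProduct, Complex.re_sum]
      refine Finset.sum_congr rfl (fun i _ => ?_)
      simp; ring
    rw [this, ← hs, Finset.mul_sum, Finset.mul_sum, ← Finset.sum_sub_distrib, ← Finset.sum_add_distrib]
    refine Finset.sum_congr rfl (fun i _ => ?_)
    rw [Pi.add_apply, Pi.smul_apply, norm_sq_add_smul]
    simp
    ring
  have hZ : ∀ t : ℝ, ∑ i, ∑ j, ‖(Y + t • Rw w) i j‖ ^ 2
      = ∑ i, ∑ j, ‖Y i j‖ ^ 2 + 2 * t * (qf (hB Y) w / κ) + t ^ 2 * ((κ - 1) ^ 2 / κ ^ 2) := by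
    intro t
    rw [hκd, ← sum_star_mul_Rw, ← hκd, ← hs, hκd, ← sum_norm_Rw]
    simp only [Finset.mul_sum, ← Finset.sum_add_distrib]
    refine Finset.sum_congr rfl (fun i _ => Finset.sum_congr rfl (fun j _ => ?_))
    rw [Pi.add_apply, Pi.add_apply, Pi.smul_apply, Pi.smul_apply, norm_sq_add_smul]
  have hmain : ∀ t : ℝ, Qf (Psi (fib (w, Y, b, y) t)) =
      (t - (-(qf (hB Y) w) + t / κ * (κ - 1))) ^ 2
      + 2 * (∑ i, ‖h i‖ ^ 2 - 2 * (t / κ) * qf (hB Y) w + (t / κ) ^ 2 * (κ - 1))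
      + (∑ i, ∑ j, ‖Y i j‖ ^ 2 + 2 * t * (qf (hB Y) w / κ) + t ^ 2 * ((κ - 1) ^ 2 / κ ^ 2))
      + (b ^ 2 + 2 * ∑ i, ‖y i‖ ^ 2) := by
    intro t
    rw [← hq, ← hsum, ← hZ, ← hNw]
    rfl
  rw [hmain, hmain]
  field_simp
  ring

lemma det_fib {m : ℕ} {F : Matrix (Fin m) (Fin m) ℂ} (d : Fin m → ℝ) :
    Complex.normSq (Fᴴ * diagonal (fun j => ((d j : ℝ) : ℂ)) * F).det
      = Complex.normSq F.det ^ 2 * (∏ j, d j) ^ 2 := by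
  rw [Matrix.det_mul, Matrix.det_mul, Matrix.det_diagonal, Matrix.det_conjTranspose,
    ← Complex.ofReal_prod, Complex.normSq_mul, Complex.normSq_mul, Complex.normSq_ofReal]
  simp
  ring

def PP (m : ℕ) : Set (EE m) := {p | (Nm p).PosDef}
def E0 (m : ℕ) (δ L : ℝ) : Set (EE m) :=
  {p | (Nm p).PosDef ∧ ¬ (Nm p - (δ : ℂ) • Sw p.2.1).PosDef ∧ |p.1| ≤ L}

lemma fiber_bound {m : ℕ} (q : (Fin m → ℂ) × FF m) (δ L : ℝ) (hL : 1 ≤ L) (hδ : 0 < δ)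
    (hδL : δ * L ≤ 1) :
    ∫⁻ t in {t | fib q t ∈ E0 m δ L}, ENNReal.ofReal (Jac (fib q t))
      ≤ ENNReal.ofReal (Real.exp (3 / 2) * (δ * L) ^ 3) *
        ∫⁻ t in {t | fib q t ∈ PP m}, ENNReal.ofReal (Jac (fib q t)) := by
  obtain ⟨F, μ, hF, hFμ⟩ := simul_diag (Sw q.1) (hB q.2.1) (Sw_posDef _) (hB_isHermitian _)
  have hN : ∀ t : ℝ, Nm (fib q t) = Fᴴ * diagonal (fun j => ((t - μ j : ℝ) : ℂ)) * F := by
    intro t; rw [Nm_fib, hFμ]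
  have hPD : ∀ t : ℝ, (Nm (fib q t)).PosDef ↔ ∀ j, 0 < t - μ j := by
    intro t; rw [hN, posDef_congr_diag hF]
  have hPD2 : ∀ t : ℝ, (Nm (fib q t) - (δ : ℂ) • Sw (fib q t).2.1).PosDef ↔ ∀ j, 0 < t - δ - μ j := by
    intro t
    have : Nm (fib q t) - (δ : ℂ) • Sw (fib q t).2.1 = Nm (fib q (t - δ)) := by
      rw [Nm_fib, Nm_fib]
      simp only [fib, Complex.ofReal_sub, sub_smul]
      abel
    rw [this, hPD]
  rcases isEmpty_or_nonempty (Fin m) with hm | hm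
  · have : {t | fib q t ∈ E0 m δ L} = ∅ := by
      ext t
      simp only [Set.mem_ofPred_eq, Set.mem_empty_iff_false, iff_false]
      rintro ⟨_, h, _⟩
      exact h ((hPD2 t).2 (fun j => hm.elim j))
    rw [this]; simp
  obtain ⟨j0, hj0⟩ := Finite.exists_max μ
  set a := μ j0 with ha
  have hA : {t | fib q t ∈ E0 m δ L} = {t | a < t ∧ t ≤ a + δ ∧ |t| ≤ L} := by
    ext t
    have hf1 : (fib q t).1 = t := rfl
    simp only [Set.mem_ofPred_eq, E0, hPD, hPD2, hf1]
    refine and_congr ⟨fun h => by linarith [h j0], fun h j => by linarith [hj0 j]⟩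
      (and_congr ⟨fun h => ?_, fun h h' => by linarith [h' j0]⟩ Iff.rfl)
    push Not at h
    obtain ⟨j, hj⟩ := h
    linarith [hj0 j]
  have hB : {t | fib q t ∈ PP m} = Set.Ioi a := by
    ext t
    simp only [Set.mem_ofPred_eq, PP, hPD, Set.mem_Ioi]
    exact ⟨fun h => by linarith [h j0], fun h j => by linarith [hj0 j]⟩
  set c0 : ℝ := ((1 + ∑ i, ‖q.1 i‖ ^ 2) * Complex.normSq F.det ^ 2)
    * Real.exp (-(Qf (Psi (fib q 0))) / 2) with hc0
  have hc00 : 0 ≤ c0 := by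
    have := kap_pos q.1
    positivity
  set r : ℝ → ℝ := fun t => ∏ j ∈ Finset.univ.erase j0, (t - μ j) ^ 2 with hr
  have hJ : ∀ t : ℝ, ENNReal.ofReal (Jac (fib q t)) = ENNReal.ofReal c0 *
      ENNReal.ofReal (((t - a) ^ 2 * r t) * Real.exp (-(t ^ 2) / 2)) := by
    intro t
    rw [← ENNReal.ofReal_mul hc00]
    congr 1
    rw [Jac, Qf_fib, hN, det_fib]
    have h1 : (∏ j, (t - μ j)) ^ 2 = (t - a) ^ 2 * r t := by
      rw [hr, ← Finset.prod_pow, ← Finset.mul_prod_erase _ _ (Finset.mem_univ j0)]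
    have h2 : Real.exp (-(t ^ 2 + Qf (Psi (fib q 0))) / 2)
        = Real.exp (-(Qf (Psi (fib q 0))) / 2) * Real.exp (-(t ^ 2) / 2) := by
      rw [← Real.exp_add]; congr 1; ring
    have h3 : (fib q t).2.1 = q.1 := rfl
    rw [h1, h2, hc0, h3]
    ring
  rw [hA, hB]
  simp only [hJ]
  rw [lintegral_const_mul' _ _ (by simp), lintegral_const_mul' _ _ (by simp), mul_left_comm]
  gcongr
  refine oneD a L δ r hL hδ hδL (fun t _ => Finset.prod_nonneg (fun j _ => sq_nonneg _)) ?_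
  intro t u ht htu
  refine Finset.prod_le_prod (fun j _ => sq_nonneg _) (fun j _ => ?_)
  have := hj0 j
  apply pow_le_pow_left₀ <;> linarith

instance instB1 (m:ℕ) : BorelSpace (FF m) := inferInstance
set_option synthInstance.maxHeartbeats 200000 in
instance instB2 (m:ℕ) : BorelSpace (EE m) := inferInstance
instance instS1 (m:ℕ) : SFinite (volume : Measure (ℝ × (Fin m → ℂ))) := 
  inferInstanceAs (SFinite (Measure.prod volume volume))
instance instS2 (m:ℕ) : SFinite (volume : Measure (FF m)) := 
  inferInstanceAs (SFinite (Measure.prod volume volume))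
instance instS3 (m:ℕ) : SFinite (volume : Measure ((Fin m → ℂ) × FF m)) := 
  inferInstanceAs (SFinite (Measure.prod volume volume))
instance instH1 (m:ℕ) : (volume : Measure (ℝ × (Fin m → ℂ))).IsAddHaarMeasure :=
  Measure.prod.instIsAddHaarMeasure _ _
instance instH0 (m:ℕ) : (volume : Measure ((Fin m → Fin m → ℂ))).IsAddHaarMeasure :=
  Measure.pi.isAddHaarMeasure _
instance instH2 (m:ℕ) : (volume : Measure (FF m)).IsAddHaarMeasure :=
  Measure.prod.instIsAddHaarMeasure _ _
instance instH3 (m:ℕ) : (volume : Measure ((Fin m → ℂ) × FF m)).IsAddHaarMeasure :=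
  Measure.prod.instIsAddHaarMeasure _ _
instance instH4 (m:ℕ) : (volume : Measure (EE m)).IsAddHaarMeasure :=
  Measure.prod.instIsAddHaarMeasure _ _


def sph (m : ℕ) : Set (Fin m → ℂ) := {z | ∑ i, ‖z i‖ ^ 2 = 1}

lemma isCompact_sph (m : ℕ) : IsCompact (sph m) := by
  apply Metric.isCompact_of_isClosed_isBounded
  · exact isClosed_eq (by fun_prop) continuous_const
  · refine (Metric.isBounded_closedBall (x := (0 : Fin m → ℂ)) (r := 1)).subset ?_
    intro z hz
    rw [mem_closedBall_zero_iff, pi_norm_le_iff_of_nonneg zero_le_one]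
    intro i
    have h : ‖z i‖ ^ 2 ≤ ∑ i, ‖z i‖ ^ 2 :=
      Finset.single_le_sum (f := fun i => ‖z i‖ ^ 2) (fun i _ => by positivity) (Finset.mem_univ i)
    have h2 : ∑ i, ‖z i‖ ^ 2 = 1 := hz
    rw [h2] at h
    exact (sq_le_one_iff₀ (norm_nonneg _)).1 h

lemma isClosed_exists {X V : Type*} [TopologicalSpace X] [TopologicalSpace V] {K : Set V}
    (hK : IsCompact K) {C : Set (X × V)} (hC : IsClosed C) :
    IsClosed {x | ∃ z ∈ K, (x, z) ∈ C} := by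
  have : CompactSpace K := isCompact_iff_compactSpace.1 hK
  have h := isClosedMap_fst_of_compactSpace (X := X) (Y := K)
  have h2 : IsClosed ((fun y : X × K => (y.1, (y.2 : V))) ⁻¹' C) := hC.preimage (by fun_prop)
  have h3 := h _ h2
  convert h3 using 1
  ext x
  constructor
  · rintro ⟨z, hz, hc⟩
    exact ⟨(x, ⟨z, hz⟩), hc, rfl⟩
  · rintro ⟨⟨x', z⟩, hc, rfl⟩
    exact ⟨z, z.2, hc⟩

lemma qf_smul {m : ℕ} (N : Matrix (Fin m) (Fin m) ℂ) (c : ℝ) (z : Fin m → ℂ) :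
    qf N ((c : ℂ) • z) = c ^ 2 * qf N z := by
  simp only [qf, Matrix.mulVec_smul, dotProduct_smul, star_smul, smul_dotProduct]
  simp; ring

lemma exists_sph {m : ℕ} (z : Fin m → ℂ) (hz : z ≠ 0) :
    ∃ c : ℝ, 0 < c ∧ (c : ℂ) • z ∈ sph m := by
  have hz2 : 0 < ∑ i, ‖z i‖ ^ 2 := by
    obtain ⟨i, hi⟩ := Function.ne_iff.1 hz
    refine Finset.sum_pos' (fun i _ => by positivity) ⟨i, Finset.mem_univ _, ?_⟩
    have : 0 < ‖z i‖ := norm_pos_iff.2 hi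
    positivity
  set s := ∑ i, ‖z i‖ ^ 2 with hs
  refine ⟨(Real.sqrt s)⁻¹, by positivity, ?_⟩
  have h : ∀ i, ‖(((Real.sqrt s)⁻¹ : ℝ) : ℂ) * z i‖ ^ 2 = s⁻¹ * ‖z i‖ ^ 2 := by
    intro i
    rw [norm_mul, mul_pow, Complex.norm_real, Real.norm_of_nonneg (by positivity), inv_pow,
      Real.sq_sqrt hz2.le]
  simp only [sph, Set.mem_ofPred_eq, Pi.smul_apply, smul_eq_mul, h, ← Finset.mul_sum, ← hs]
  field_simp

lemma sph_ne_zero {m : ℕ} {z : Fin m → ℂ} (hz : z ∈ sph m) : z ≠ 0 := by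
  rintro rfl
  simp [sph] at hz

lemma posDef_iff_sph {m : ℕ} {N : Matrix (Fin m) (Fin m) ℂ} (hN : N.IsHermitian) :
    N.PosDef ↔ ∀ z ∈ sph m, 0 < qf N z := by
  constructor
  · intro h z hz
    exact h.re_dotProduct_pos (sph_ne_zero hz)
  · intro h
    refine Matrix.PosDef.of_dotProduct_mulVec_pos hN (fun z hz => ?_)
    obtain ⟨c, hc, hcz⟩ := exists_sph z hz
    have h1 := h _ hcz
    rw [qf_smul] at h1
    have h2 : 0 < qf N z := by
      by_contra h3; push Not at h3
      nlinarith [sq_nonneg c]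
    have h4 := herm_swap hN z z
    have h5 : star z ⬝ᵥ (N *ᵥ z) = ((qf N z : ℝ) : ℂ) :=
      (Complex.conj_eq_iff_re.1 h4).symm
    rw [h5]
    exact_mod_cast h2

lemma continuous_hB {m : ℕ} : Continuous (hB : (Fin m → Fin m → ℂ) → Matrix (Fin m) (Fin m) ℂ) := by
  refine continuous_matrix (fun i j => ?_)
  simp only [hB_apply]
  fun_prop

lemma continuous_Nm {m : ℕ} : Continuous (Nm : EE m → Matrix (Fin m) (Fin m) ℂ) := by
  have := continuous_hB (m := m)
  unfold Nm
  fun_prop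

lemma continuous_Rw {m : ℕ} : Continuous (Rw : (Fin m → ℂ) → _) := by
  refine continuous_pi (fun i => continuous_pi (fun j => ?_))
  unfold Rw
  refine Continuous.div (by fun_prop) (by fun_prop) (fun w => ?_)
  exact_mod_cast (kap_pos w).ne'

lemma continuous_Sw {m : ℕ} : Continuous (Sw : (Fin m → ℂ) → Matrix (Fin m) (Fin m) ℂ) := by
  refine continuous_const.sub ?_
  exact continuous_Rw

lemma continuous_qf {m : ℕ} : Continuous
    (fun y : Matrix (Fin m) (Fin m) ℂ × (Fin m → ℂ) => qf y.1 y.2) := by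
  unfold qf
  exact Complex.continuous_re.comp
    (Continuous.dotProduct (by fun_prop) (Continuous.matrix_mulVec (by fun_prop) (by fun_prop)))

lemma isOpen_posDef_of {X : Type*} [TopologicalSpace X] {m : ℕ} {f : X → Matrix (Fin m) (Fin m) ℂ}
    (hf : Continuous f) (hh : ∀ x, (f x).IsHermitian) : IsOpen {x | (f x).PosDef} := by
  have hC : IsClosed {y : X × (Fin m → ℂ) | qf (f y.1) y.2 ≤ 0} := by
    refine isClosed_le ?_ continuous_const
    exact continuous_qf.comp (f := fun y : X × (Fin m → ℂ) => (f y.1, y.2)) (by fun_prop)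
  have := isClosed_exists (isCompact_sph m) hC
  rw [← isOpen_compl_iff] at this
  convert this using 1
  ext x
  simp only [Set.mem_ofPred_eq, Set.mem_compl_iff, posDef_iff_sph (hh x)]
  push Not
  rfl

lemma measurableSet_PP (m : ℕ) : MeasurableSet (PP m) :=
  (isOpen_posDef_of continuous_Nm Nm_isHermitian).measurableSet

lemma measurableSet_E0 (m : ℕ) (δ L : ℝ) : MeasurableSet (E0 m δ L) := by
  refine (measurableSet_PP m).inter (MeasurableSet.inter ?_ ?_)
  · refine (isOpen_posDef_of (f := fun p : EE m => Nm p - (δ : ℂ) • Sw p.2.1) ?_ ?_).measurableSet.compl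
    · have := continuous_Nm (m := m)
      have := continuous_Sw (m := m)
      fun_prop
    · intro p
      refine (Nm_isHermitian p).sub ?_
      unfold Matrix.IsHermitian
      rw [Matrix.conjTranspose_smul, (Sw_isHermitian _).eq]; simp
  · exact measurableSet_le (f := fun p : EE m => |p.1|) (by fun_prop) measurable_const

lemma Psi_injOn {m : ℕ} : Set.InjOn (Psi : EE m → EE m) (PP m) := by
  have main : ∀ (l l' : ℝ) (w w' : Fin m → ℂ) (f : FF m), (Nm (l, w, f)).PosDef →
      Psi (l, w, f) = Psi (l', w', f) → l ≤ l' → (l, w, f) = (l', w', f) := by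
    intro l l' w w' f hp he hl
    set N := Nm (l, w, f) with hN
    have hN' : Nm (l', w', f) = N + ((l' - l : ℝ) : ℂ) • (1 : Matrix (Fin m) (Fin m) ℂ) := by
      rw [hN]; simp only [Nm, Complex.ofReal_sub, sub_smul]; abel
    have h1 : N *ᵥ w = Nm (l', w', f) *ᵥ w' := congrArg (fun v => v.2.1) he
    have h2 : l - qf N w = l' - qf (Nm (l', w', f)) w' := congrArg (fun v => v.1) he
    set d := l' - l with hd
    have h3 : N *ᵥ (w - w') = (d : ℂ) • w' := by
      rw [Matrix.mulVec_sub, h1, hN', Matrix.add_mulVec, Matrix.smul_mulVec, Matrix.one_mulVec]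
      abel
    have hd0 : 0 ≤ d := by linarith
    rcases hd0.eq_or_lt with hd0 | hd0
    · have hinj : w - w' = 0 := by
        by_contra hne
        have := hp.re_dotProduct_pos hne
        rw [h3, ← hd0] at this
        simp at this
      have : l = l' := by linarith
      rw [this, sub_eq_zero.1 hinj]
    exfalso
    have hx : qf N w = (star w ⬝ᵥ (N *ᵥ w' + (d : ℂ) • w')).re := by
      rw [qf, h1, hN', Matrix.add_mulVec, Matrix.smul_mulVec, Matrix.one_mulVec]
    have hx' : qf (Nm (l', w', f)) w' = (star w' ⬝ᵥ (N *ᵥ w' + (d : ℂ) • w')).re := by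
      rw [qf, hN', Matrix.add_mulVec, Matrix.smul_mulVec, Matrix.one_mulVec]
    have h4 : d = -(star (w - w') ⬝ᵥ (N *ᵥ w' + (d : ℂ) • w')).re := by
      rw [star_sub, sub_dotProduct, Complex.sub_re, ← hx, ← hx']; linarith
    have h5 : (star (w - w') ⬝ᵥ (N *ᵥ w')).re = d * ∑ i, ‖w' i‖ ^ 2 := by
      rw [herm_swap_re (Nm_isHermitian _), h3, dotProduct_smul, re_star_dot_self,
        smul_eq_mul, Complex.re_ofReal_mul, Complex.ofReal_re]
    have h6 : (star (w - w') ⬝ᵥ ((d : ℂ) • w')).re = qf N (w - w') := by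
      rw [qf, h3]
    rw [dotProduct_add, Complex.add_re, h5, h6] at h4
    have h7 : 0 ≤ qf N (w - w') := by
      by_cases hne : w - w' = 0
      · rw [hne]; simp [qf]
      · exact (hp.re_dotProduct_pos hne).le
    have := kap_pos w'
    nlinarith
  rintro ⟨l, w, f⟩ hp ⟨l', w', f'⟩ hp' he
  have hf : f = f' := congrArg (fun v => v.2.2) he
  subst hf
  rcases le_total l l' with h | h
  · exact main l l' w w' f hp he h
  · exact (main l' l w' w f hp' he.symm h).symm

lemma continuous_Psi {m : ℕ} : Continuous (Psi : EE m → EE m) :=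
  continuous_iff_continuousAt.2 (fun p => (hasFDerivAt_Psi p).continuousAt)

lemma continuous_Qf {m : ℕ} : Continuous (Qf : EE m → ℝ) := by
  unfold Qf; fun_prop

lemma measurable_Jac {m : ℕ} : Measurable (fun p : EE m => ENNReal.ofReal (Jac p)) := by
  have h1 := continuous_Psi (m := m)
  have h2 := continuous_Qf (m := m)
  have h3 := continuous_Nm (m := m)
  have h4 : Continuous (fun p : EE m => (Nm p).det) := h3.matrix_det
  have : Continuous (Jac : EE m → ℝ) := by
    unfold Jac
    have := Complex.continuous_normSq
    fun_prop
  exact this.measurable.ennreal_ofReal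

lemma image_lintegral {m : ℕ} {A : Set (EE m)} (hA : MeasurableSet A) (hAP : A ⊆ PP m) :
    ∫⁻ v in Psi '' A, ENNReal.ofReal (Real.exp (-(Qf v) / 2)) = ∫⁻ p in A, ENNReal.ofReal (Jac p) := by
  rw [lintegral_image_eq_lintegral_abs_det_fderiv_mul volume hA
    (fun p _ => (hasFDerivAt_Psi p).hasFDerivWithinAt) (Psi_injOn.mono hAP)]
  refine lintegral_congr (fun p => ?_)
  rw [← ENNReal.ofReal_mul (abs_nonneg _), det_DPsi, Jac, abs_of_nonneg]
  exact mul_nonneg (kap_pos _).le (Complex.normSq_nonneg _)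

lemma measurableSet_image_E0 (m : ℕ) (δ L : ℝ) : MeasurableSet (Psi '' (E0 m δ L)) :=
  measurable_image_of_fderivWithin (measurableSet_E0 m δ L)
    (fun p _ => (hasFDerivAt_Psi p).hasFDerivWithinAt) (Psi_injOn.mono (fun _ h => h.1))

lemma mp_fib (m : ℕ) : MeasurePreserving (fun y : EE m => fib y.2 y.1) volume volume := by
  have hR : Measurable (Rw : (Fin m → ℂ) → _) := continuous_Rw.measurable
  refine MeasurePreserving.skew_product (f := id)
    (g := fun (t : ℝ) (q : (Fin m → ℂ) × FF m) => (q.1, (q.2.1 + t • Rw q.1, q.2.2))) (MeasurePreserving.id _) ?_ ?_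
  · unfold Function.uncurry
    fun_prop
  · refine Filter.Eventually.of_forall (fun t => ?_)
    refine MeasurePreserving.map_eq ?_
    refine MeasurePreserving.skew_product (f := id)
      (g := fun (w : Fin m → ℂ) (f : FF m) => (f.1 + t • Rw w, f.2)) (MeasurePreserving.id _) ?_ ?_
    · unfold Function.uncurry
      fun_prop
    · refine Filter.Eventually.of_forall (fun w => ?_)
      have := map_add_right_eq_self (volume : Measure (FF m)) (t • Rw w, 0)
      have e : (fun f : FF m => (f.1 + t • Rw w, f.2)) = fun x => x + (t • Rw w, 0) := by
        funext f
        simp [Prod.ext_iff]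
      rw [← e] at this
      exact this

lemma fib_lintegral {m : ℕ} {A : Set (EE m)} (hA : MeasurableSet A) :
    ∫⁻ p in A, ENNReal.ofReal (Jac p)
      = ∫⁻ q, ∫⁻ t in {t | fib q t ∈ A}, ENNReal.ofReal (Jac (fib q t)) := by
  have hm : Measurable (A.indicator (fun p : EE m => ENNReal.ofReal (Jac p))) :=
    measurable_Jac.indicator hA
  rw [← lintegral_indicator hA, ← (mp_fib m).lintegral_comp hm]
  have hm2 := hm.comp (mp_fib m).measurable
  refine (lintegral_prod_symm _ hm2.aemeasurable).trans ?_
  refine lintegral_congr (fun q => ?_)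
  have hms : MeasurableSet {t | fib q t ∈ A} :=
    ((mp_fib m).measurable.comp (g := fun y : EE m => fib y.2 y.1) (f := fun t => (t, q))
      (by fun_prop)) hA
  rw [← lintegral_indicator hms]
  rfl

theorem E0_bound (m : ℕ) (δ L : ℝ) (hL : 1 ≤ L) (hδ : 0 < δ) (hδL : δ * L ≤ 1) :
    ∫⁻ v in Psi '' (E0 m δ L), ENNReal.ofReal (Real.exp (-(Qf v) / 2))
      ≤ ENNReal.ofReal (Real.exp (3 / 2) * (δ * L) ^ 3) *
        ∫⁻ v : EE m, ENNReal.ofReal (Real.exp (-(Qf v) / 2)) := by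
  have h1 : ∫⁻ v in Psi '' (PP m), ENNReal.ofReal (Real.exp (-(Qf v) / 2))
    ≤ ∫⁻ v : EE m, ENNReal.ofReal (Real.exp (-(Qf v) / 2)) := setLIntegral_le_lintegral _ _
  refine le_trans ?_ (mul_le_mul_right h1 _)
  rw [image_lintegral (measurableSet_E0 m δ L) (fun _ h => h.1),
    image_lintegral (measurableSet_PP m) subset_rfl, fib_lintegral (measurableSet_E0 m δ L),
    fib_lintegral (measurableSet_PP m), ← lintegral_const_mul' _ _ (by simp)]
  exact lintegral_mono (fun q => fiber_bound q δ L hL hδ hδL)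

lemma lintegral_pi_prod {n : ℕ} {X : Type*} [MeasurableSpace X] (μ : Fin n → Measure X)
    [∀ i, SigmaFinite (μ i)] (f : Fin n → X → ENNReal) (hf : ∀ i, Measurable (f i)) :
    ∫⁻ x, ∏ i, f i (x i) ∂(Measure.pi μ) = ∏ i, ∫⁻ x, f i x ∂(μ i) := by
  induction n with
  | zero => simp
  | succ n ih =>
    have hmp := (measurePreserving_piFinSuccAbove μ 0).symm
    rw [← hmp.lintegral_comp_emb (MeasurableEquiv.measurableEmbedding _), Fin.prod_univ_succ]
    have h2 := ih (fun j => μ (Fin.succ j)) (fun j => f (Fin.succ j)) (fun j => hf _)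
    rw [← h2, ← lintegral_prod_mul (hf 0).aemeasurable]
    · refine lintegral_congr (fun y => ?_)
      rw [Fin.prod_univ_succ]
      rfl
    · refine (Finset.measurable_prod _ (fun i _ => ?_)).aemeasurable
      exact (hf _).comp (measurable_pi_apply i)

lemma pi_withDensity {n : ℕ} {X : Type*} [MeasurableSpace X] (μ : Measure X) [SigmaFinite μ]
    (g : X → ENNReal) (hg : Measurable g) (hfin : SigmaFinite (μ.withDensity g)) :
    Measure.pi (fun _ : Fin n => μ.withDensity g)
      = (Measure.pi (fun _ : Fin n => μ)).withDensity (fun x => ∏ i, g (x i)) := by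
  refine Measure.pi_eq (fun s hs => ?_)
  rw [withDensity_apply _ (MeasurableSet.univ_pi hs), ← lintegral_indicator (MeasurableSet.univ_pi hs)]
  have : ∀ x : Fin n → X, (Set.univ.pi s).indicator (fun x => ∏ i, g (x i)) x
      = ∏ i, (s i).indicator g (x i) := by
    intro x
    by_cases hx : x ∈ Set.univ.pi s
    · rw [Set.indicator_of_mem hx]
      refine Finset.prod_congr rfl (fun i _ => ?_)
      rw [Set.indicator_of_mem (hx i (Set.mem_univ i))]
    · rw [Set.indicator_of_notMem hx]
      simp only [Set.mem_univ_pi, not_forall] at hx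
      obtain ⟨i, hi⟩ := hx
      refine (Finset.prod_eq_zero (Finset.mem_univ i) ?_).symm
      rw [Set.indicator_of_notMem hi]
  simp only [this]
  rw [lintegral_pi_prod _ _ (fun i => hg.indicator (hs i))]
  refine Finset.prod_congr rfl (fun i _ => ?_)
  rw [lintegral_indicator (hs i), withDensity_apply _ (hs i)]

instance instCG : IsProbabilityMeasure complexGaussian := by
  unfold complexGaussian
  refine Measure.isProbabilityMeasure_map ?_
  exact (Complex.measurableEquivRealProd.symm.measurable).aemeasurable

noncomputable def cgD (z : ℂ) : ENNReal :=
  ENNReal.ofReal ((Real.sqrt (2 * Real.pi))⁻¹ ^ 2) * ENNReal.ofReal (Real.exp (-‖z‖ ^ 2 / 2))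

lemma measurable_cgD : Measurable cgD := by unfold cgD; fun_prop

lemma complexGaussian_eq : complexGaussian = volume.withDensity cgD := by
  have h1 : (gaussianReal 0 1).prod (gaussianReal 0 1)
      = (volume : Measure (ℝ × ℝ)).withDensity (fun p => gaussianPDF 0 1 p.1 * gaussianPDF 0 1 p.2) := by
    rw [gaussianReal_of_var_ne_zero _ one_ne_zero,
      prod_withDensity (measurable_gaussianPDF _ _) (measurable_gaussianPDF _ _)]
    rfl
  have hmp := Complex.volume_preserving_equiv_real_prod.symm
  ext s hs
  have hms : Measurable (fun p : ℝ × ℝ => Complex.mk p.1 p.2) :=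
    Complex.measurableEquivRealProd.symm.measurable
  rw [complexGaussian, Measure.map_apply hms hs, h1, withDensity_apply _ (hms hs),
    withDensity_apply _ hs]
  rw [← hmp.setLIntegral_comp_preimage hs measurable_cgD]
  refine lintegral_congr (fun p => ?_)
  change _ = cgD (Complex.mk p.1 p.2)
  have hn : ‖Complex.mk p.1 p.2‖ ^ 2 = p.1 ^ 2 + p.2 ^ 2 := by
    rw [← Complex.normSq_eq_norm_sq, Complex.normSq_mk]; ring
  rw [gaussianPDF, gaussianPDF, cgD, ← ENNReal.ofReal_mul (gaussianPDFReal_nonneg _ _ _),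
    ← ENNReal.ofReal_mul (by positivity), hn]
  congr 1
  simp only [gaussianPDFReal, NNReal.coe_one, mul_one, sub_zero]
  have : Real.exp (-(p.1 ^ 2 + p.2 ^ 2) / 2) = Real.exp (-p.1 ^ 2 / 2) * Real.exp (-p.2 ^ 2 / 2) := by
    rw [← Real.exp_add]; congr 1; ring
  rw [this]; ring

/-- `matrixGaussian` on the function space. -/
noncomputable def mG (n : ℕ) : Measure (Fin n → Fin n → ℂ) :=
  Measure.pi fun _ : Fin n => Measure.pi fun _ : Fin n => complexGaussian

instance instmG (n : ℕ) : IsProbabilityMeasure (mG n) := by unfold mG; infer_instance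

lemma mG_eq (n : ℕ) : ∃ C : ENNReal, C ≠ ⊤ ∧ ∀ A : Set (Fin n → Fin n → ℂ), MeasurableSet A →
    mG n A = C * ∫⁻ G in A, ENNReal.ofReal (Real.exp (-(∑ i, ∑ j, ‖G i j‖ ^ 2) / 2)) := by
  have hs1 : SigmaFinite ((volume : Measure ℂ).withDensity cgD) := by
    rw [← complexGaussian_eq]; infer_instance
  have h1 : Measure.pi (fun _ : Fin n => complexGaussian)
      = (volume : Measure (Fin n → ℂ)).withDensity (fun x => ∏ i, cgD (x i)) := by
    rw [complexGaussian_eq, pi_withDensity _ _ measurable_cgD hs1]; rfl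
  have hm1 : Measurable (fun x : Fin n → ℂ => ∏ i, cgD (x i)) := by
    have := measurable_cgD
    fun_prop
  have hs2 : SigmaFinite ((volume : Measure (Fin n → ℂ)).withDensity (fun x => ∏ i, cgD (x i))) := by
    rw [← h1]; infer_instance
  have h2 : mG n = (volume : Measure (Fin n → Fin n → ℂ)).withDensity
      (fun x => ∏ i, ∏ j, cgD (x i j)) := by
    rw [mG, h1, pi_withDensity _ _ hm1 hs2]; rfl
  refine ⟨∏ i : Fin n, ∏ j : Fin n, ENNReal.ofReal ((Real.sqrt (2 * Real.pi))⁻¹ ^ 2), ?_, ?_⟩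
  · exact ENNReal.prod_ne_top (fun i _ => ENNReal.prod_ne_top (fun j _ => ENNReal.ofReal_ne_top))
  · intro A hA
    rw [h2, withDensity_apply _ hA, ← lintegral_const_mul' _ _
      (ENNReal.prod_ne_top (fun i _ => ENNReal.prod_ne_top (fun j _ => ENNReal.ofReal_ne_top)))]
    refine lintegral_congr (fun G => ?_)
    simp only [cgD, Finset.prod_mul_distrib]
    congr 1
    simp only [← Finset.sum_neg_distrib, Finset.sum_div, Real.exp_sum]
    rw [ENNReal.ofReal_prod_of_nonneg (fun i _ => Finset.prod_nonneg (fun j _ => (Real.exp_pos _).le))]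
    refine Finset.prod_congr rfl (fun i _ => ?_)
    rw [ENNReal.ofReal_prod_of_nonneg (fun j _ => (Real.exp_pos _).le)]

noncomputable def eL (m : ℕ) : EE m ≃ₗ[ℝ] (Fin (m + 1) → Fin (m + 1) → ℂ) where
  toFun v := Fin.cons (Fin.cons (Complex.mk v.1 v.2.2.2.1) (fun j => star (v.2.1 j - v.2.2.2.2 j)))
    (fun i => Fin.cons (v.2.1 i + v.2.2.2.2 i) (v.2.2.1 i))
  invFun G := ((G 0 0).re, (fun i => (G i.succ 0 + star (G 0 i.succ)) / 2,
    (fun i j => G i.succ j.succ, ((G 0 0).im, fun i => (G i.succ 0 - star (G 0 i.succ)) / 2))))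
  map_add' u v := by
    funext i j
    refine Fin.cases ?_ (fun i => ?_) i <;> refine Fin.cases ?_ (fun j => ?_) j
    · simp [Complex.ext_iff]
    · simp; ring
    · simp; ring
    · simp
  map_smul' c v := by
    funext i j
    refine Fin.cases ?_ (fun i => ?_) i <;> refine Fin.cases ?_ (fun j => ?_) j
    · simp [Complex.ext_iff]
    · simp; ring
    · simp
    · simp
  left_inv v := by
    obtain ⟨a, x, Z, b, y⟩ := v
    simp
  right_inv G := by
    funext i j
    refine Fin.cases ?_ (fun i => ?_) i <;> refine Fin.cases ?_ (fun j => ?_) j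
    · simp
    · simp; ring
    · simp; ring
    · simp

noncomputable def eC (m : ℕ) : EE m ≃L[ℝ] (Fin (m + 1) → Fin (m + 1) → ℂ) :=
  (eL m).toContinuousLinearEquiv

lemma Qf_eC {m : ℕ} (v : EE m) : ∑ i, ∑ j, ‖eC m v i j‖ ^ 2 = Qf v := by
  have hp : ∀ a b : ℂ, ‖a - b‖ ^ 2 + ‖a + b‖ ^ 2 = 2 * ‖a‖ ^ 2 + 2 * ‖b‖ ^ 2 := by
    intro a b
    simp only [← Complex.normSq_eq_norm_sq, Complex.normSq_apply]
    simp; ring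
  have h00 : eC m v 0 0 = Complex.mk v.1 v.2.2.2.1 := rfl
  have h0 : ∀ j : Fin m, eC m v 0 j.succ = star (v.2.1 j - v.2.2.2.2 j) := fun j => rfl
  have h1 : ∀ i : Fin m, eC m v i.succ 0 = v.2.1 i + v.2.2.2.2 i := fun j => rfl
  have h2 : ∀ i j : Fin m, eC m v i.succ j.succ = v.2.2.1 i j := fun i j => rfl
  have hn : ‖Complex.mk v.1 v.2.2.2.1‖ ^ 2 = v.1 ^ 2 + v.2.2.2.1 ^ 2 := by
    rw [← Complex.normSq_eq_norm_sq, Complex.normSq_mk]; ring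
  simp only [Fin.sum_univ_succ, h00, h0, h1, h2, norm_star, hn, Finset.sum_add_distrib, Qf]
  have : ∑ i, ‖v.2.1 i - v.2.2.2.2 i‖ ^ 2 + ∑ i, ‖v.2.1 i + v.2.2.2.2 i‖ ^ 2
      = 2 * ∑ i, ‖v.2.1 i‖ ^ 2 + 2 * ∑ i, ‖v.2.2.2.2 i‖ ^ 2 := by
    rw [← Finset.sum_add_distrib, Finset.mul_sum, Finset.mul_sum, ← Finset.sum_add_distrib]
    exact Finset.sum_congr rfl (fun i _ => hp _ _)
  linarith

lemma mG_eC (m : ℕ) : ∃ D : ENNReal, D ≠ 0 ∧ D ≠ ⊤ ∧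
    D = ∫⁻ v : EE m, ENNReal.ofReal (Real.exp (-(Qf v) / 2)) ∧
    ∀ A : Set (EE m), MeasurableSet A →
    mG (m + 1) (eC m '' A) * D = ∫⁻ v in A, ENNReal.ofReal (Real.exp (-(Qf v) / 2)) := by
  obtain ⟨C, hC, hmG⟩ := mG_eq (m + 1)
  have hH : (Measure.map (eC m) (volume : Measure (EE m))).IsAddHaarMeasure :=
    (eC m).isAddHaarMeasure_map _
  have hc := Measure.isAddLeftInvariant_eq_smul
    (Measure.map (eC m) (volume : Measure (EE m))) (volume : Measure (Fin (m+1) → Fin (m+1) → ℂ))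
  have hc0 := Measure.addHaarScalarFactor_pos_of_isAddHaarMeasure
    (Measure.map (eC m) (volume : Measure (EE m))) (volume : Measure (Fin (m+1) → Fin (m+1) → ℂ))
  set c := Measure.addHaarScalarFactor
    (Measure.map (eC m) (volume : Measure (EE m))) (volume : Measure (Fin (m+1) → Fin (m+1) → ℂ))
  have hme : MeasurableEmbedding (eC m) := (eC m).toHomeomorph.measurableEmbedding
  set W : (Fin (m+1) → Fin (m+1) → ℂ) → ENNReal :=
    fun G => ENNReal.ofReal (Real.exp (-(∑ i, ∑ j, ‖G i j‖ ^ 2) / 2)) with hW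
  have hWm : Measurable W := by rw [hW]; fun_prop
  have hpull : ∀ A : Set (EE m), MeasurableSet A →
      ∫⁻ v in A, ENNReal.ofReal (Real.exp (-(Qf v) / 2)) = (c : ENNReal) * ∫⁻ G in eC m '' A, W G := by
    intro A hA
    have hA' : MeasurableSet (eC m '' A) := hme.measurableSet_image' hA
    have h1 : ∫⁻ G in eC m '' A, W G ∂(Measure.map (eC m) (volume : Measure (EE m)))
        = ∫⁻ v in A, ENNReal.ofReal (Real.exp (-(Qf v) / 2)) := by
      rw [setLIntegral_map hA' hWm hme.measurable, Set.preimage_image_eq _ hme.injective]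
      refine lintegral_congr (fun v => ?_)
      rw [hW, ← Qf_eC]
    rw [← h1, hc, Measure.restrict_smul, lintegral_smul_measure]
    rfl
  have huniv := hpull Set.univ MeasurableSet.univ
  have himg : eC m '' Set.univ = Set.univ := by
    rw [Set.image_univ]; exact (eC m).surjective.range_eq
  rw [himg, Measure.restrict_univ, Measure.restrict_univ] at huniv
  have h1 : C * ∫⁻ G, W G = 1 := by
    have := hmG Set.univ MeasurableSet.univ
    rw [Measure.restrict_univ, measure_univ] at this
    exact this.symm
  have hI0 : ∫⁻ G, W G ≠ 0 := by
    intro h; rw [h, mul_zero] at h1; exact zero_ne_one h1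
  have hIt : ∫⁻ G, W G ≠ ⊤ := by
    intro h; rw [h] at h1
    by_cases hC0 : C = 0
    · rw [hC0, zero_mul] at h1; exact zero_ne_one h1
    · rw [ENNReal.mul_top hC0] at h1; exact ENNReal.top_ne_one h1
  refine ⟨_, ?_, ?_, rfl, ?_⟩
  · rw [huniv]
    exact mul_ne_zero (by exact_mod_cast hc0.ne') hI0
  · rw [huniv]
    exact ENNReal.mul_ne_top ENNReal.coe_ne_top hIt
  · intro A hA
    rw [huniv, hpull A hA, hmG _ (hme.measurableSet_image' hA)]
    calc C * (∫⁻ G in eC m '' A, W G) * (c * ∫⁻ G, W G)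
        = (C * ∫⁻ G, W G) * (c * ∫⁻ G in eC m '' A, W G) := by ring
      _ = _ := by rw [h1, one_mul]

lemma measurableSet_eC_image {m : ℕ} {A : Set (EE m)} (hA : MeasurableSet A) :
    MeasurableSet (eC m '' A) :=
  (eC m).toHomeomorph.measurableEmbedding.measurableSet_image' hA

theorem mG_E0 (m : ℕ) (δ L : ℝ) (hL : 1 ≤ L) (hδ : 0 < δ) :
    mG (m + 1) (eC m '' (Psi '' (E0 m δ L))) ≤ ENNReal.ofReal (Real.exp (3 / 2) * (δ * L) ^ 3) := by
  by_cases hδL : δ * L ≤ 1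
  · obtain ⟨D, hD0, hDt, hD, h⟩ := mG_eC m
    have h1 := h _ (measurableSet_image_E0 m δ L)
    have h2 := E0_bound m δ L hL hδ hδL
    rw [← h1, ← hD] at h2
    exact (ENNReal.mul_le_mul_iff_left hD0 hDt).1 h2
  · refine prob_le_one.trans ?_
    rw [← ENNReal.ofReal_one]
    apply ENNReal.ofReal_le_ofReal
    push Not at hδL
    have h1 : 1 ≤ Real.exp (3 / 2) := Real.one_le_exp (by norm_num)
    have h2 : 1 ≤ (δ * L) ^ 3 := one_le_pow₀ hδL.le
    nlinarith

lemma mG_null_of (m : ℕ) (A : Set (EE m)) (hA : MeasurableSet A) (h0 : volume A = 0) :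
    mG (m + 1) (eC m '' A) = 0 := by
  obtain ⟨D, hD0, hDt, hD, h⟩ := mG_eC m
  have h1 := h _ hA
  rw [setLIntegral_measure_zero _ _ h0] at h1
  exact (mul_eq_zero.1 h1).resolve_right hD0

/-- lower right block -/
def blk {m : ℕ} (G : Fin (m + 1) → Fin (m + 1) → ℂ) : Fin m → Fin m → ℂ :=
  fun i j => G i.succ j.succ

/-- first column (below the diagonal) of the Hermitian part -/
noncomputable def xcol {m : ℕ} (G : Fin (m + 1) → Fin (m + 1) → ℂ) : Fin m → ℂ :=
  fun i => hB G i.succ 0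

lemma mulVec_zero' {m : ℕ} (G : Fin (m + 1) → Fin (m + 1) → ℂ) (u : Fin (m + 1) → ℂ) :
    (hB G *ᵥ u) 0 = ((G 0 0).re : ℂ) * u 0 + star (xcol G) ⬝ᵥ (fun i => u i.succ) := by
  simp only [Matrix.mulVec, dotProduct, Fin.sum_univ_succ]
  congr 1
  · congr 1
    rw [hB_apply]
    apply Complex.ext <;> simp
    ring
  · refine Finset.sum_congr rfl (fun i _ => ?_)
    congr 1
    rw [Pi.star_apply, xcol, ← (hB_isHermitian G).apply]

lemma mulVec_succ' {m : ℕ} (G : Fin (m + 1) → Fin (m + 1) → ℂ) (u : Fin (m + 1) → ℂ) (i : Fin m) :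
    (hB G *ᵥ u) i.succ = xcol G i * u 0 + (hB (blk G) *ᵥ (fun i => u i.succ)) i := by
  simp only [Matrix.mulVec, dotProduct, Fin.sum_univ_succ]
  rfl

lemma qf_cons {m : ℕ} (G : Fin (m + 1) → Fin (m + 1) → ℂ) (u : Fin (m + 1) → ℂ) :
    qf (hB G) u = ‖u 0‖ ^ 2 * (G 0 0).re
      + 2 * (star (u 0) * (star (xcol G) ⬝ᵥ (fun i => u i.succ))).re
      + qf (hB (blk G)) (fun i => u i.succ) := by
  have h1 : star u ⬝ᵥ (hB G *ᵥ u) = star (u 0) * (hB G *ᵥ u) 0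
      + ∑ i : Fin m, star (u i.succ) * (hB G *ᵥ u) i.succ := by
    simp only [dotProduct, Fin.sum_univ_succ]; rfl
  have h2 : ∑ i : Fin m, star (u i.succ) * (hB G *ᵥ u) i.succ
      = star (star (u 0) * (star (xcol G) ⬝ᵥ (fun i => u i.succ)))
        + star (fun i : Fin m => u i.succ) ⬝ᵥ (hB (blk G) *ᵥ (fun i => u i.succ)) := by
    simp only [mulVec_succ', mul_add, Finset.sum_add_distrib]
    congr 1
    simp only [dotProduct, star_mul', star_star, star_sum, Finset.mul_sum, Pi.star_apply]
    exact Finset.sum_congr rfl (fun i _ => by ring)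
  rw [qf, h1, h2, mulVec_zero', mul_add]
  have h3 : star (u 0) * (((G 0 0).re : ℂ) * u 0) = ((‖u 0‖ ^ 2 * (G 0 0).re : ℝ) : ℂ) := by
    have := Complex.conj_mul' (u 0)
    rw [RCLike.star_def, mul_left_comm, this]
    push_cast; ring
  rw [h3]
  simp only [Complex.add_re, Complex.ofReal_re, qf]
  have h4 : ∀ a : ℂ, (star a).re = a.re := fun a => Complex.conj_re a
  rw [h4]
  ring

def BadG (m : ℕ) : Set (Fin (m + 1) → Fin (m + 1) → ℂ) :=
  {G | ∃ z ∈ sph m, ∀ u ∈ sph (m + 1), qf (hB G) u ≤ qf (hB (blk G)) z}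

lemma qf_le_of_sph {m : ℕ} {N : Matrix (Fin m) (Fin m) ℂ} {M : ℝ} (h : ∀ u ∈ sph m, qf N u ≤ M)
    (z : Fin m → ℂ) : qf N z ≤ M * ∑ i, ‖z i‖ ^ 2 := by
  by_cases hz : z = 0
  · subst hz; simp [qf]
  obtain ⟨c, hc, hcz⟩ := exists_sph z hz
  have h1 := h _ hcz
  rw [qf_smul] at h1
  have h2 : c ^ 2 * ∑ i, ‖z i‖ ^ 2 = 1 := by
    have : ∑ i, ‖((c : ℂ) • z) i‖ ^ 2 = 1 := hcz
    rw [← this, Finset.mul_sum]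
    refine Finset.sum_congr rfl (fun i _ => ?_)
    rw [Pi.smul_apply, smul_eq_mul, norm_mul, Complex.norm_real, mul_pow, Real.norm_of_nonneg hc.le]
  have h3 : c ^ 2 * qf N z ≤ c ^ 2 * (M * ∑ i, ‖z i‖ ^ 2) := by
    calc _ ≤ M := h1
      _ = M * (c ^ 2 * ∑ i, ‖z i‖ ^ 2) := by rw [h2, mul_one]
      _ = _ := by ring
  exact le_of_mul_le_mul_left h3 (by positivity)

lemma continuous_blk {m : ℕ} : Continuous (blk : (Fin (m + 1) → Fin (m + 1) → ℂ) → _) := by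
  unfold blk; fun_prop

lemma isClosed_BadG (m : ℕ) : IsClosed (BadG m) := by
  have h := isClosed_exists (X := Fin (m + 1) → Fin (m + 1) → ℂ) (isCompact_sph m)
    (C := {y | ∀ u ∈ sph (m + 1), qf (hB y.1) u ≤ qf (hB (blk y.1)) y.2}) ?_
  · exact h
  · simp only [Set.ofPred_forall]
    refine isClosed_iInter (fun u => isClosed_iInter (fun _ => ?_))
    have h1 := continuous_hB (m := m)
    have h2 := continuous_hB (m := m + 1)
    have h3 := continuous_blk (m := m)
    refine isClosed_le ?_ ?_
    · exact continuous_qf.comp (f := fun y : (Fin (m + 1) → Fin (m + 1) → ℂ) × (Fin m → ℂ) =>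
        (hB y.1, u)) (by fun_prop)
    · exact continuous_qf.comp (f := fun y : (Fin (m + 1) → Fin (m + 1) → ℂ) × (Fin m → ℂ) =>
        (hB (blk y.1), y.2)) (by fun_prop)

lemma blk_eC {m : ℕ} (v : EE m) : blk (eC m v) = v.2.2.1 := rfl

lemma xcol_eC {m : ℕ} (v : EE m) : xcol (eC m v) = v.2.1 := by
  funext i
  have h0 : eC m v 0 i.succ = star (v.2.1 i - v.2.2.2.2 i) := rfl
  have h1 : eC m v i.succ 0 = v.2.1 i + v.2.2.2.2 i := rfl
  rw [xcol, hB_apply, h0, h1, star_star]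
  ring

lemma zero_eC {m : ℕ} (v : EE m) : (eC m v 0 0).re = v.1 := rfl

/-- first variation -/
lemma bad_orth {m : ℕ} {G : Fin (m + 1) → Fin (m + 1) → ℂ} (hG : G ∈ BadG m) {z0 : Fin m → ℂ}
    (hz0 : z0 ∈ sph m) (hmax : ∀ z ∈ sph m, qf (hB (blk G)) z ≤ qf (hB (blk G)) z0) :
    star (xcol G) ⬝ᵥ z0 = 0 := by
  obtain ⟨z, hz, hb⟩ := hG
  set M := qf (hB (blk G)) z0 with hM
  have h1 := qf_le_of_sph (fun u hu => (hb u hu).trans (hmax z hz))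
  by_contra hc
  set c := star (xcol G) ⬝ᵥ z0 with hcd
  set a := (G 0 0).re with ha
  set t : ℝ := 1 / (|M - a| + 1) with ht
  have ht0 : 0 < t := by positivity
  have h2 := h1 (Fin.cons ((t : ℂ) * c) z0)
  rw [qf_cons, Fin.sum_univ_succ] at h2
  simp only [Fin.cons_zero, Fin.cons_succ] at h2
  have hz1 : ∑ i, ‖z0 i‖ ^ 2 = 1 := hz0
  have h3 : (star ((t : ℂ) * c) * c).re = t * ‖c‖ ^ 2 := by
    have : star ((t : ℂ) * c) * c = ((t * ‖c‖ ^ 2 : ℝ) : ℂ) := by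
      rw [star_mul', RCLike.star_def, Complex.conj_ofReal, mul_assoc, Complex.conj_mul']
      push_cast; rfl
    rw [this, Complex.ofReal_re]
  have h4 : ‖(t : ℂ) * c‖ ^ 2 = t ^ 2 * ‖c‖ ^ 2 := by
    rw [norm_mul, Complex.norm_real, Real.norm_of_nonneg ht0.le, mul_pow]
  rw [hz1, ← hcd, h3, h4] at h2
  have hc2 : 0 < ‖c‖ ^ 2 := by
    have := norm_pos_iff.2 hc
    positivity
  change t ^ 2 * ‖c‖ ^ 2 * a + 2 * (t * ‖c‖ ^ 2) + M ≤ M * (t ^ 2 * ‖c‖ ^ 2 + 1) at h2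
  have h5 : (2 : ℝ) * (t * ‖c‖ ^ 2) ≤ ((M - a) * t) * (t * ‖c‖ ^ 2) := by nlinarith
  have h6 : 2 ≤ (M - a) * t := le_of_mul_le_mul_right h5 (by positivity)
  have h7 : (M - a) * t ≤ 1 := by
    rw [ht, mul_one_div, div_le_one (by positivity)]
    linarith [le_abs_self (M - a)]
  linarith

lemma null_hyper {m : ℕ} {z0 : Fin m → ℂ} (hz0 : z0 ∈ sph m) :
    volume {x : Fin m → ℂ | star x ⬝ᵥ z0 = 0} = 0 := by
  let s : Submodule ℝ (Fin m → ℂ) :=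
    { carrier := {x | star x ⬝ᵥ z0 = 0}
      add_mem' := by
        intro a b ha hb
        simp only [Set.mem_ofPred_eq] at *
        rw [star_add, add_dotProduct, ha, hb, add_zero]
      zero_mem' := by simp
      smul_mem' := by
        intro c x hx
        simp only [Set.mem_ofPred_eq] at *
        rw [star_smul, smul_dotProduct, hx, smul_zero] }
  have hs : s ≠ ⊤ := by
    intro h
    have h1 : z0 ∈ s := by rw [h]; trivial
    have h2 : star z0 ⬝ᵥ z0 = 0 := h1
    rw [re_star_dot_self] at h2
    have h3 : ∑ i, ‖z0 i‖ ^ 2 = 1 := hz0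
    rw [h3] at h2
    simp at h2
  exact Measure.addHaar_submodule volume s hs

lemma mG_BadG (m : ℕ) : mG (m + 1) (BadG m) = 0 := by
  have hA : MeasurableSet (eC m ⁻¹' BadG m) :=
    ((isClosed_BadG m).preimage (eC m).continuous).measurableSet
  have himg : eC m '' (eC m ⁻¹' BadG m) = BadG m :=
    Set.image_preimage_eq _ (eC m).surjective
  rw [← himg]
  refine mG_null_of m _ hA ?_
  change (Measure.prod volume (Measure.prod volume volume)) (eC m ⁻¹' BadG m) = 0
  rw [Measure.prod_apply hA]
  refine (lintegral_congr (fun a => ?_)).trans lintegral_zero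
  rw [Measure.prod_apply_symm (measurable_prodMk_left hA)]
  refine (lintegral_congr (fun f => ?_)).trans lintegral_zero
  by_cases hne : (sph m).Nonempty
  · obtain ⟨z0, hz0, hmax⟩ := (isCompact_sph m).exists_isMaxOn hne
      (f := fun z => qf (hB f.1) z)
      (continuous_qf.comp (f := fun z : Fin m → ℂ => (hB f.1, z)) (by fun_prop)).continuousOn
    refine measure_mono_null ?_ (null_hyper hz0)
    intro x hx
    have hx' : eC m (a, x, f) ∈ BadG m := hx
    have := bad_orth hx' hz0 (fun z hz => by rw [blk_eC]; exact hmax hz)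
    rw [xcol_eC] at this
    exact this
  · refine measure_mono_null (t := ∅) ?_ measure_empty
    rintro x ⟨z, hz, _⟩
    exact hne ⟨z, hz⟩

lemma eig_raw {n : ℕ} {H : Matrix (Fin n) (Fin n) ℂ} (hH : H.IsHermitian) :
    ∃ v : Fin n → Fin n → ℂ, (∀ k, v k ∈ sph n) ∧ (∀ k l, k ≠ l → star (v k) ⬝ᵥ v l = 0) ∧
      (∀ k, H *ᵥ v k = (hH.eigenvalues k : ℂ) • v k) ∧
      (∀ z, ∑ k, ‖star (v k) ⬝ᵥ z‖ ^ 2 = ∑ i, ‖z i‖ ^ 2) ∧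
      (∀ z, qf H z = ∑ k, hH.eigenvalues k * ‖star (v k) ⬝ᵥ z‖ ^ 2) := by
  set U : Matrix (Fin n) (Fin n) ℂ := (hH.eigenvectorUnitary : Matrix (Fin n) (Fin n) ℂ) with hU
  have hUU : Uᴴ * U = 1 := Unitary.coe_star_mul_self hH.eigenvectorUnitary
  have hUU' : U * Uᴴ = 1 := Unitary.coe_mul_star_self hH.eigenvectorUnitary
  have hst : H = U * diagonal (fun k => (hH.eigenvalues k : ℂ)) * Uᴴ := by
    have := hH.spectral_theorem
    rw [Unitary.conjStarAlgAut_apply] at this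
    exact this
  set D := diagonal (fun k => (hH.eigenvalues k : ℂ)) with hD
  have hdot : ∀ k l, star (fun i => U i k) ⬝ᵥ (fun i => U i l) = (1 : Matrix (Fin n) (Fin n) ℂ) k l := by
    intro k l
    rw [← hUU]; rfl
  have hy : ∀ z k, star (fun i => U i k) ⬝ᵥ z = (Uᴴ *ᵥ z) k := fun z k => rfl
  have hnorm : ∀ z, ∑ k, ‖star (fun i => U i k) ⬝ᵥ z‖ ^ 2 = ∑ i, ‖z i‖ ^ 2 := by
    intro z
    simp only [hy]
    have h1 := re_star_dot_self (Uᴴ *ᵥ z)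
    rw [Matrix.star_mulVec, conjTranspose_conjTranspose, ← Matrix.dotProduct_mulVec, Matrix.mulVec_mulVec, hUU',
      Matrix.one_mulVec, re_star_dot_self] at h1
    exact_mod_cast h1.symm
  refine ⟨fun k i => U i k, fun k => ?_, fun k l hkl => ?_, fun k => ?_, hnorm, fun z => ?_⟩
  · have h1 := hdot k k
    rw [re_star_dot_self, Matrix.one_apply_eq] at h1
    exact_mod_cast h1
  · rw [hdot, Matrix.one_apply_ne hkl]
  · have h1 : H * U = U * D := by
      rw [hst, Matrix.mul_assoc, hUU, Matrix.mul_one]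
    funext i
    have h2 : (H * U) i k = (U * D) i k := by rw [h1]
    rw [hD, Matrix.mul_diagonal] at h2
    rw [Pi.smul_apply, smul_eq_mul, mul_comm]
    exact h2
  · simp only [hy]
    rw [qf]
    conv_lhs => rw [hst]
    rw [← Matrix.mulVec_mulVec, ← Matrix.mulVec_mulVec, Matrix.dotProduct_mulVec]
    have h3 : star z ᵥ* U = star (Uᴴ *ᵥ z) := by
      rw [Matrix.star_mulVec, conjTranspose_conjTranspose]
    rw [h3, hD]
    simp only [dotProduct, Matrix.mulVec_diagonal, Complex.re_sum]
    refine Finset.sum_congr rfl (fun k _ => ?_)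
    have h4 : (star (Uᴴ *ᵥ z)) k * ((hH.eigenvalues k : ℂ) * (Uᴴ *ᵥ z) k)
        = ((hH.eigenvalues k * ‖(Uᴴ *ᵥ z) k‖ ^ 2 : ℝ) : ℂ) := by
      rw [Pi.star_apply, RCLike.star_def, mul_left_comm, Complex.conj_mul']
      push_cast; rfl
    rw [h4, Complex.ofReal_re]

lemma eig_data {m : ℕ} (hm : 1 ≤ m) {H : Matrix (Fin (m + 1)) (Fin (m + 1)) ℂ} (hH : H.IsHermitian)
    (h1 : m < m + 1) (h2 : m - 1 < m + 1) :
    ∃ v u : Fin (m + 1) → ℂ, v ∈ sph (m + 1) ∧ u ∈ sph (m + 1) ∧ star v ⬝ᵥ u = 0 ∧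
      H *ᵥ v = (sortedEigs H ⟨m, h1⟩ : ℂ) • v ∧ H *ᵥ u = (sortedEigs H ⟨m - 1, h2⟩ : ℂ) • u ∧
      sortedEigs H ⟨m - 1, h2⟩ ≤ sortedEigs H ⟨m, h1⟩ ∧
      (∀ z, qf H z ≤ sortedEigs H ⟨m, h1⟩ * ∑ i, ‖z i‖ ^ 2) ∧
      (∀ z, qf H z ≤ sortedEigs H ⟨m - 1, h2⟩ * ∑ i, ‖z i‖ ^ 2 +
        (sortedEigs H ⟨m, h1⟩ - sortedEigs H ⟨m - 1, h2⟩) * ‖star v ⬝ᵥ z‖ ^ 2) := by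
  obtain ⟨v, hv1, hv2, hv3, hv4, hv5⟩ := eig_raw hH
  have hs : sortedEigs H = hH.eigenvalues ∘ (Tuple.sort hH.eigenvalues) := by
    rw [sortedEigs, dif_pos hH]
  have hmono := Tuple.monotone_sort hH.eigenvalues
  rw [hs]
  set σ := Tuple.sort hH.eigenvalues with hσ
  have hmax : ∀ k, hH.eigenvalues k ≤ (hH.eigenvalues ∘ σ) ⟨m, h1⟩ := by
    intro k
    have := hmono (show σ.symm k ≤ ⟨m, h1⟩ from Nat.lt_succ_iff.1 (σ.symm k).2)
    simpa using this
  have hmax2 : ∀ k, k ≠ σ ⟨m, h1⟩ → hH.eigenvalues k ≤ (hH.eigenvalues ∘ σ) ⟨m - 1, h2⟩ := by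
    intro k hk
    have hne : σ.symm k ≠ ⟨m, h1⟩ := fun h => hk (by rw [← h]; simp)
    have hne' : (σ.symm k : ℕ) ≠ m := fun h => hne (Fin.ext h)
    have hlt := (σ.symm k).2
    have := hmono (show σ.symm k ≤ ⟨m - 1, h2⟩ from by rw [Fin.le_def]; simp only; omega)
    simpa using this
  have hle : (hH.eigenvalues ∘ σ) ⟨m - 1, h2⟩ ≤ (hH.eigenvalues ∘ σ) ⟨m, h1⟩ :=
    hmono (by rw [Fin.le_def]; simp only; omega)
  refine ⟨v (σ ⟨m, h1⟩), v (σ ⟨m - 1, h2⟩), hv1 _, hv1 _, hv2 _ _ ?_, hv3 _, hv3 _, hle, ?_, ?_⟩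
  · intro h
    have := congrArg Fin.val (σ.injective h)
    simp only at this
    omega
  · intro z
    rw [hv5, ← hv4 z, Finset.mul_sum]
    exact Finset.sum_le_sum (fun k _ => mul_le_mul_of_nonneg_right (hmax k) (by positivity))
  · intro z
    rw [hv5, ← hv4 z, Finset.mul_sum]
    rw [← Finset.add_sum_erase _ _ (Finset.mem_univ (σ ⟨m, h1⟩)),
      ← Finset.add_sum_erase _ _ (Finset.mem_univ (σ ⟨m, h1⟩))]
    have : ∑ x ∈ Finset.univ.erase (σ ⟨m, h1⟩), hH.eigenvalues x * ‖star (v x) ⬝ᵥ z‖ ^ 2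
      ≤ ∑ x ∈ Finset.univ.erase (σ ⟨m, h1⟩), (hH.eigenvalues ∘ σ) ⟨m - 1, h2⟩ * ‖star (v x) ⬝ᵥ z‖ ^ 2 :=
      Finset.sum_le_sum (fun k hk => mul_le_mul_of_nonneg_right
        (hmax2 k (Finset.ne_of_mem_erase hk)) (by positivity))
    simp only [Function.comp_apply] at *
    linarith

lemma qf_pos {m : ℕ} {N : Matrix (Fin m) (Fin m) ℂ} (hN : N.PosDef) {z : Fin m → ℂ} (hz : z ≠ 0) :
    0 < qf N z := hN.re_dotProduct_pos hz

lemma qf_eq {m : ℕ} {N : Matrix (Fin m) (Fin m) ℂ} {z : Fin m → ℂ} {a : ℝ} (h : N *ᵥ z = (a : ℂ) • z) :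
    qf N z = a * ∑ i, ‖z i‖ ^ 2 := by
  rw [qf, h, dotProduct_smul, re_star_dot_self, smul_eq_mul, ← Complex.ofReal_mul, Complex.ofReal_re]

lemma qf_Nm {m : ℕ} (p : EE m) (z : Fin m → ℂ) :
    qf (Nm p) z = p.1 * ∑ i, ‖z i‖ ^ 2 - qf (hB p.2.2.1) z := by
  rw [qf, Nm, Matrix.sub_mulVec, dotProduct_sub, Complex.sub_re, ← qf, ← qf]
  congr 1
  apply qf_eq
  rw [Matrix.smul_mulVec, Matrix.one_mulVec]

lemma Nm_mulVec {m : ℕ} (p : EE m) (z : Fin m → ℂ) :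
    Nm p *ᵥ z = (p.1 : ℂ) • z - hB p.2.2.1 *ᵥ z := by
  rw [Nm, Matrix.sub_mulVec, Matrix.smul_mulVec, Matrix.one_mulVec]

lemma cover4 {m : ℕ} {G : Fin (m + 1) → Fin (m + 1) → ℂ} {v u : Fin (m + 1) → ℂ} {l1 l2 δ L : ℝ}
    (hv : v ∈ sph (m + 1)) (hu : u ∈ sph (m + 1)) (ho : star v ⬝ᵥ u = 0)
    (hHv : hB G *ᵥ v = (l1 : ℂ) • v) (hHu : hB G *ᵥ u = (l2 : ℂ) • u)
    (hmax : ∀ z, qf (hB G) z ≤ l1 * ∑ i, ‖z i‖ ^ 2) (hnb : G ∉ BadG m)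
    (hgap : l1 - l2 ≤ δ) (hL : |l1| ≤ L) :
    G ∈ eC m '' (Psi '' E0 m δ L) := by
  set v' : Fin m → ℂ := fun i => v i.succ with hv'
  set u' : Fin m → ℂ := fun i => u i.succ with hu'
  set w : Fin m → ℂ := (v 0)⁻¹ • v' with hw
  set p : EE m := (l1, w, ((eC m).symm G).2.2) with hp
  have hGe : eC m ((eC m).symm G) = G := (eC m).apply_symm_apply G
  have hblk : p.2.2.1 = blk G := by
    conv_rhs => rw [← hGe]
    rw [blk_eC]
  have hx : ((eC m).symm G).2.1 = xcol G := by
    conv_rhs => rw [← hGe]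
    rw [xcol_eC]
  have ha : ((eC m).symm G).1 = (G 0 0).re := by
    conv_rhs => rw [← hGe]
    rw [zero_eC]
  have hPD : (Nm p).PosDef := by
    rw [posDef_iff_sph (Nm_isHermitian p)]
    intro z hz
    rw [qf_Nm, hblk]
    have hz1 : ∑ i, ‖z i‖ ^ 2 = 1 := hz
    rw [hz1, mul_one, sub_pos]
    by_contra hcon
    apply hnb
    refine ⟨z, hz, fun y hy => ?_⟩
    have hy1 : ∑ i, ‖y i‖ ^ 2 = 1 := hy
    have := hmax y
    rw [hy1, mul_one] at this
    exact this.trans (not_lt.1 hcon)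
  have hv1 : ∑ i, ‖v i‖ ^ 2 = 1 := hv
  have hu1 : ∑ i, ‖u i‖ ^ 2 = 1 := hu
  rw [Fin.sum_univ_succ] at hv1 hu1
  have hNv : Nm p *ᵥ v' = (v 0) • xcol G := by
    rw [Nm_mulVec, hblk]
    funext i
    have h1 := congrFun hHv i.succ
    rw [mulVec_succ'] at h1
    simp only [Pi.sub_apply, Pi.smul_apply, smul_eq_mul] at h1 ⊢
    change l1 * v i.succ - (hB (blk G) *ᵥ v') i = _
    rw [← h1]; ring
  have hNu : Nm p *ᵥ u' = ((l1 - l2 : ℝ) : ℂ) • u' + (u 0) • xcol G := by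
    rw [Nm_mulVec, hblk]
    funext i
    have h1 := congrFun hHu i.succ
    rw [mulVec_succ'] at h1
    simp only [Pi.sub_apply, Pi.add_apply, Pi.smul_apply, smul_eq_mul] at h1 ⊢
    change l1 * u i.succ - (hB (blk G) *ᵥ u') i = ((l1 - l2 : ℝ) : ℂ) * u i.succ + _
    have h2 : (hB (blk G) *ᵥ u') i = l2 * u i.succ - xcol G i * u 0 := by rw [← h1]; ring
    rw [h2]; push_cast; ring
  have hv0 : v 0 ≠ 0 := by
    intro h0
    rw [h0, zero_smul] at hNv
    have hne : v' ≠ 0 := by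
      intro h
      have : ∀ i : Fin m, v i.succ = 0 := fun i => congrFun h i
      simp [h0, this] at hv1
    have := qf_pos hPD hne
    rw [qf, hNv] at this
    simp at this
  have hNw : Nm p *ᵥ w = xcol G := by
    rw [hw, Matrix.mulVec_smul, hNv, smul_smul, inv_mul_cancel₀ hv0, one_smul]
  have hvw : v' = v 0 • w := by
    rw [hw, smul_smul, mul_inv_cancel₀ hv0, one_smul]
  have hstar : ∀ a b : Fin m → ℂ, (star a ⬝ᵥ b).re = (star b ⬝ᵥ a).re := by
    intro a b
    simp only [dotProduct, Complex.re_sum]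
    exact Finset.sum_congr rfl (fun i _ => by simp; ring)
  have hal : (G 0 0).re = l1 - qf (Nm p) w := by
    have h1 := congrFun hHv 0
    rw [mulVec_zero'] at h1
    change _ + star (xcol G) ⬝ᵥ v' = l1 * v 0 at h1
    rw [hvw, dotProduct_smul, smul_eq_mul] at h1
    have h2 : ((G 0 0).re : ℂ) + star (xcol G) ⬝ᵥ w = l1 := by
      apply mul_left_cancel₀ hv0
      rw [mul_add, mul_comm (v 0) (l1 : ℂ), ← h1]; ring
    have h3 := congrArg Complex.re h2
    rw [Complex.add_re, Complex.ofReal_re, Complex.ofReal_re, hstar] at h3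
    rw [qf, hNw]; linarith
  have hu0 : star w ⬝ᵥ u' = - u 0 := by
    have h1 : star v ⬝ᵥ u = star (v 0) * u 0 + star v' ⬝ᵥ u' := by
      simp only [dotProduct, Fin.sum_univ_succ]; rfl
    rw [ho, hvw, star_smul, smul_dotProduct, smul_eq_mul, ← mul_add] at h1
    have h2 : star (v 0) ≠ 0 := star_ne_zero.2 hv0
    have h3 := (mul_eq_zero.1 h1.symm).resolve_left h2
    linear_combination h3
  set z : Fin m → ℂ := u' - u 0 • w with hz
  have hNz : Nm p *ᵥ z = ((l1 - l2 : ℝ) : ℂ) • u' := by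
    rw [hz, Matrix.mulVec_sub, hNu, Matrix.mulVec_smul, hNw]; abel
  have hSz : Sw w *ᵥ z = u' := by
    rw [Sw, Matrix.sub_mulVec, Matrix.one_mulVec, Rw_mulVec]
    have hk : ((1 + ∑ i, ‖w i‖ ^ 2 : ℝ) : ℂ) ≠ 0 := by
      exact_mod_cast (kap_pos w).ne'
    have h1 : star w ⬝ᵥ z = - u 0 * ((1 + ∑ i, ‖w i‖ ^ 2 : ℝ) : ℂ) := by
      rw [hz, dotProduct_sub, hu0, dotProduct_smul, re_star_dot_self, smul_eq_mul]
      push_cast; ring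
    rw [h1, mul_div_cancel_right₀ _ hk, hz, neg_smul]; abel
  have hzne : z ≠ 0 := by
    intro h
    rw [h, Matrix.mulVec_zero] at hSz
    have h0 : u 0 = 0 := by
      rw [← hSz, dotProduct_zero] at hu0
      exact neg_eq_zero.1 hu0.symm
    have : ∀ i : Fin m, u i.succ = 0 := fun i => (congrFun hSz i).symm
    simp [h0, this] at hu1
  refine ⟨(eC m).symm G, ⟨p, ⟨hPD, ?_, hL⟩, ?_⟩, hGe⟩
  · intro hcon
    have h1 := qf_pos hcon hzne
    have h2 := qf_pos (Sw_posDef w) hzne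
    rw [qf, hSz] at h2
    change 0 < (star z ⬝ᵥ ((Nm p - (δ : ℂ) • Sw w) *ᵥ z)).re at h1
    rw [Matrix.sub_mulVec, Matrix.smul_mulVec, hNz, hSz, ← sub_smul, dotProduct_smul, smul_eq_mul,
      ← Complex.ofReal_sub, Complex.re_ofReal_mul] at h1
    nlinarith
  · rw [Psi]
    change (l1 - qf (Nm p) w, Nm p *ᵥ w, ((eC m).symm G).2.2) = (eC m).symm G
    rw [← hal, hNw, ← hx, ← ha]

def T1 (n : ℕ) (Λ : ℝ) : Set (Fin n → Fin n → ℂ) := {G | ∃ u ∈ sph n, Λ ≤ qf (hB G) u}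
def T2 (n : ℕ) (Λ : ℝ) : Set (Fin n → Fin n → ℂ) := {G | ∑ i, max (G i i).re 0 ≤ Λ}

lemma isClosed_T1 (n : ℕ) (Λ : ℝ) : IsClosed (T1 n Λ) := by
  refine isClosed_exists (X := Fin n → Fin n → ℂ) (isCompact_sph n)
    (C := {y | Λ ≤ qf (hB y.1) y.2}) ?_
  have h2 := continuous_hB (m := n)
  refine isClosed_le continuous_const ?_
  exact continuous_qf.comp (f := fun y : (Fin n → Fin n → ℂ) × (Fin n → ℂ) =>
    (hB y.1, y.2)) (by fun_prop)

lemma isClosed_T2 (n : ℕ) (Λ : ℝ) : IsClosed (T2 n Λ) := by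
  refine isClosed_le ?_ continuous_const
  fun_prop

lemma hB_of_herm {n : ℕ} {H : Matrix (Fin n) (Fin n) ℂ} (hH : H.IsHermitian) :
    hB (H : Fin n → Fin n → ℂ) = H := by
  ext i j
  refine (hB_apply (fun i j => H i j) i j).trans ?_
  rw [hH.apply]
  ring

def TT (m : ℕ) (δ Λ : ℝ) : Set (Fin (m + 1) → Fin (m + 1) → ℂ) :=
  T1 (m + 1) Λ ∪ T2 (m + 1) Λ ∪ BadG m ∪ eC m '' (Psi '' E0 m δ Λ)

lemma hB_diag_re {n : ℕ} (G : Fin n → Fin n → ℂ) (i : Fin n) : (hB G i i).re = (G i i).re := by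
  rw [hB_apply]; simp; ring

lemma blk_hB {m : ℕ} (G : Fin (m + 1) → Fin (m + 1) → ℂ) : blk (hB G) = hB (blk G) := rfl

lemma TT_sat {m : ℕ} {δ Λ : ℝ} {G : Fin (m + 1) → Fin (m + 1) → ℂ} (h : (hB G : Fin (m+1) → Fin (m+1) → ℂ) ∈ TT m δ Λ) :
    G ∈ TT m δ Λ := by
  have hh : hB (hB G : Fin (m+1) → Fin (m+1) → ℂ) = hB G := hB_of_herm (hB_isHermitian G)
  have hb : hB (blk (hB G)) = hB (blk G) := by
    rw [blk_hB]; exact hB_of_herm (hB_isHermitian _)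
  have hxc : xcol (hB G : Fin (m+1) → Fin (m+1) → ℂ) = xcol G := by
    funext i; exact congrFun (congrFun hh i.succ) 0
  rcases h with ((h | h) | h) | h
  · left; left; left
    obtain ⟨u, hu, h⟩ := h
    exact ⟨u, hu, by rwa [hh] at h⟩
  · left; left; right
    change ∑ i, max (hB G i i).re 0 ≤ Λ at h
    simp only [hB_diag_re] at h
    exact h
  · left; right
    obtain ⟨z, hz, h⟩ := h
    refine ⟨z, hz, fun u hu => ?_⟩
    have := h u hu
    rwa [hh, hb] at this
  · right
    obtain ⟨_, ⟨p, hp, rfl⟩, hpe⟩ := h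
    have hGe : eC m ((eC m).symm G) = G := (eC m).apply_symm_apply G
    have hblk : ((eC m).symm G).2.2.1 = blk G := by
      conv_rhs => rw [← hGe]
      rw [blk_eC]
    have hx : ((eC m).symm G).2.1 = xcol G := by
      conv_rhs => rw [← hGe]
      rw [xcol_eC]
    have ha : ((eC m).symm G).1 = (G 0 0).re := by
      conv_rhs => rw [← hGe]
      rw [zero_eC]
    have hblk' : p.2.2.1 = blk (hB G) := by
      rw [← hpe, blk_eC]; rfl
    have hx' : Nm p *ᵥ p.2.1 = xcol G := by
      rw [← hxc, ← hpe, xcol_eC]; rfl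
    have ha' : p.1 - qf (Nm p) p.2.1 = (G 0 0).re := by
      rw [← hB_diag_re G, ← hpe, zero_eC]; rfl
    set q : EE m := (p.1, p.2.1, ((eC m).symm G).2.2) with hq
    have hNm : Nm q = Nm p := by
      rw [Nm, Nm, hblk', hb]
      change (p.1 : ℂ) • _ - hB ((eC m).symm G).2.2.1 = _
      rw [hblk]
    refine ⟨(eC m).symm G, ⟨q, ⟨?_, ?_, hp.2.2⟩, ?_⟩, hGe⟩
    · rw [hNm]; exact hp.1
    · rw [hNm]; exact hp.2.1
    · rw [Psi, hNm]
      change (p.1 - qf (Nm p) p.2.1, Nm p *ᵥ p.2.1, ((eC m).symm G).2.2) = (eC m).symm G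
      rw [ha', hx', ← hx, ← ha]

lemma qf_single {n : ℕ} (H : Matrix (Fin n) (Fin n) ℂ) (i : Fin n) :
    qf H (Pi.single i 1) = (H i i).re := by
  rw [qf, ← Pi.single_star, star_one, Matrix.mulVec_single_one, single_one_dotProduct]
  rfl

lemma cover {m : ℕ} (hm : 1 ≤ m) {H : Matrix (Fin (m + 1)) (Fin (m + 1)) ℂ} (h1 : m < m + 1)
    (h2 : m - 1 < m + 1) {x Λ : ℝ} (hx : 1 ≤ x) (hΛ : 0 ≤ Λ)
    (hS : |sortedEigs H ⟨m, h1⟩| < Real.exp (1 / x) * |sortedEigs H ⟨m - 1, h2⟩|) :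
    (H : Fin (m + 1) → Fin (m + 1) → ℂ) ∈ TT m (2 * Λ / x) Λ := by
  have hH : H.IsHermitian := by
    by_contra hH
    have : sortedEigs H = 0 := by rw [sortedEigs, dif_neg hH]
    simp [this] at hS
  obtain ⟨v, u, hv, hu, ho, hHv, hHu, hle, hmax, hmax2⟩ := eig_data hm hH h1 h2
  set l1 := sortedEigs H ⟨m, h1⟩ with hl1
  set l2 := sortedEigs H ⟨m - 1, h2⟩ with hl2
  have hBH := hB_of_herm hH
  have hv1 : ∑ i, ‖v i‖ ^ 2 = 1 := hv
  by_cases c1 : Λ ≤ l1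
  · left; left; left
    refine ⟨v, hv, ?_⟩
    rw [hBH, qf_eq hHv, hv1, mul_one]; exact c1
  push Not at c1
  by_cases c2 : l2 < 0
  · left; left; right
    change ∑ i, max (H i i).re 0 ≤ Λ
    rw [← mul_one Λ, ← hv1, Finset.mul_sum]
    refine Finset.sum_le_sum (fun i _ => max_le ?_ (by positivity))
    have e1 : ∑ k, ‖(Pi.single i 1 : Fin (m + 1) → ℂ) k‖ ^ 2 = 1 := by
      rw [Finset.sum_eq_single i]
      · simp
      · intro b _ hb; simp [Pi.single_eq_of_ne hb]
      · simp
    have e2 : ‖star v ⬝ᵥ (Pi.single i 1 : Fin (m + 1) → ℂ)‖ = ‖v i‖ := by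
      rw [dotProduct_single_one, Pi.star_apply, norm_star]
    have b1 := hmax (Pi.single i 1)
    have b2 := hmax2 (Pi.single i 1)
    rw [e1, qf_single] at b1 b2
    rw [e2] at b2
    have e3 : ‖v i‖ ^ 2 ≤ 1 := by
      rw [← hv1]
      exact Finset.single_le_sum (f := fun i => ‖v i‖ ^ 2) (fun i _ => by positivity) (Finset.mem_univ i)
    have e4 : 0 ≤ ‖v i‖ ^ 2 := by positivity
    rcases le_total 0 l1 with h | h
    · nlinarith
    · nlinarith
  push Not at c2
  by_cases c3 : (H : Fin (m + 1) → Fin (m + 1) → ℂ) ∈ BadG m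
  · left; right; exact c3
  right
  have hx0 : 0 < x := by linarith
  have hl10 : 0 ≤ l1 := c2.trans hle
  refine cover4 (l1 := l1) (l2 := l2) hv hu ho (by rw [hBH]; exact hHv) (by rw [hBH]; exact hHu)
    (by rw [hBH]; exact hmax) c3 ?_ (by rw [abs_of_nonneg hl10]; exact c1.le)
  rw [abs_of_nonneg hl10, abs_of_nonneg c2] at hS
  have h1x : 1 / x ≤ 1 := by rw [div_le_one hx0]; exact hx
  have h1x0 : 0 < 1 / x := by positivity
  have he := Real.abs_exp_sub_one_le (x := 1 / x) (by rw [abs_of_pos h1x0]; exact h1x)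
  have he' := le_of_abs_le he
  rw [abs_of_pos h1x0] at he'
  have : 2 * Λ / x = (2 * (1 / x)) * Λ := by ring
  rw [this]
  calc l1 - l2 ≤ (Real.exp (1 / x) - 1) * l2 := by linarith
    _ ≤ (2 * (1 / x)) * l2 := mul_le_mul_of_nonneg_right he' c2
    _ ≤ _ := mul_le_mul_of_nonneg_left (by linarith) (by positivity)

lemma measurable_aux {n : ℕ} (f : (Fin n → Fin n → ℂ) → (Fin n → Fin n → ℂ)) (hf : Continuous f) :
    Measurable f := hf.measurable

lemma GUE_bound {m : ℕ} (hm : 1 ≤ m) (h1 : m < m + 1) (h2 : m - 1 < m + 1) {x Λ : ℝ} (hx : 1 ≤ x)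
    (hΛ : 1 ≤ Λ) :
    GUE (m + 1) {H | |sortedEigs H ⟨m, h1⟩| < Real.exp (1 / x) * |sortedEigs H ⟨m - 1, h2⟩|} ≤
      mG (m + 1) (T1 (m + 1) Λ) + mG (m + 1) (T2 (m + 1) Λ)
        + ENNReal.ofReal (Real.exp (3 / 2) * (2 * Λ / x * Λ) ^ 3) := by
  have hTm : MeasurableSet (TT m (2 * Λ / x) Λ) :=
    (((isClosed_T1 _ _).measurableSet.union (isClosed_T2 _ _).measurableSet).union
      (isClosed_BadG m).measurableSet).union (measurableSet_eC_image (measurableSet_image_E0 _ _ _))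
  have hmeas : Measurable (hB : (Fin (m + 1) → Fin (m + 1) → ℂ) → (Fin (m + 1) → Fin (m + 1) → ℂ)) :=
    measurable_aux _ continuous_hB
  have hG : GUE (m + 1) (TT m (2 * Λ / x) Λ) = mG (m + 1) (hB ⁻¹' TT m (2 * Λ / x) Λ) :=
    Measure.map_apply hmeas hTm
  calc _ ≤ GUE (m + 1) (TT m (2 * Λ / x) Λ) :=
        measure_mono (fun H hH => cover hm h1 h2 hx (by linarith) hH)
    _ = mG (m + 1) (hB ⁻¹' TT m (2 * Λ / x) Λ) := hG
    _ ≤ mG (m + 1) (TT m (2 * Λ / x) Λ) := measure_mono (fun G hG => TT_sat hG)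
    _ ≤ mG (m + 1) (T1 (m + 1) Λ) + mG (m + 1) (T2 (m + 1) Λ) + mG (m + 1) (BadG m)
        + mG (m + 1) (eC m '' (Psi '' E0 m (2 * Λ / x) Λ)) := by
      refine (measure_union_le _ _).trans ?_
      gcongr
      refine (measure_union_le _ _).trans ?_
      gcongr
      exact measure_union_le _ _
    _ ≤ _ := by
      rw [mG_BadG, add_zero]
      gcongr
      exact mG_E0 m _ _ hΛ (by positivity)

noncomputable def fQ (z : ℂ) : ENNReal := ENNReal.ofReal (Real.exp (-max z.re 0))

lemma measurable_fQ : Measurable fQ := by unfold fQ; fun_prop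

lemma Q_lt : ∫⁻ z, fQ z ∂complexGaussian < 1 := by
  have h1 : ∫⁻ z, (1 : ENNReal) ∂complexGaussian = 1 := by simp
  have hle : ∀ z, fQ z ≤ 1 := by
    intro z
    rw [fQ, ENNReal.ofReal_le_one, Real.exp_le_one_iff]
    simp
  have hs : complexGaussian {z | 0 < z.re} ≠ 0 := by
    have hm : MeasurableSet {z : ℂ | 0 < z.re} := (isOpen_lt continuous_const Complex.continuous_re).measurableSet
    have hf : Measurable (fun p : ℝ × ℝ => Complex.mk p.1 p.2) := Complex.measurableEquivRealProd.symm.measurable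
    rw [complexGaussian, Measure.map_apply hf hm]
    have : (fun p : ℝ × ℝ => Complex.mk p.1 p.2) ⁻¹' {z : ℂ | 0 < z.re} = Set.Ioi 0 ×ˢ Set.univ := by
      ext p; simp
    rw [this, Measure.prod_prod, measure_univ, mul_one]
    intro h
    have := gaussianReal_absolutelyContinuous' 0 (one_ne_zero : (1 : NNReal) ≠ 0) h
    simp at this
  rw [← h1]
  refine lintegral_strict_mono_of_ae_le_of_ae_lt_on aemeasurable_const ?_ (Filter.Eventually.of_forall hle) hs
    (Filter.Eventually.of_forall ?_)
  · refine ne_top_of_le_ne_top ENNReal.one_ne_top ?_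
    rw [← h1]; exact lintegral_mono hle
  · intro z hz
    have hz' : 0 < z.re := hz
    rw [fQ, ENNReal.ofReal_lt_one, Real.exp_lt_one_iff]
    simpa using hz'

lemma exists_c0 : ∃ c0 : ℝ, 0 < c0 ∧ ∫⁻ z, fQ z ∂complexGaussian ≤ ENNReal.ofReal (Real.exp (-c0)) := by
  set Q := ∫⁻ z, fQ z ∂complexGaussian with hQ
  have hlt : Q < 1 := Q_lt
  have hfin : Q ≠ ⊤ := ne_top_of_lt hlt
  have hq : Q.toReal < 1 := by
    rw [← ENNReal.toReal_one]
    exact (ENNReal.toReal_lt_toReal hfin ENNReal.one_ne_top).2 hlt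
  have hm0 : 0 < max Q.toReal (1 / 2) := lt_max_of_lt_right (by norm_num)
  refine ⟨-Real.log (max Q.toReal (1 / 2)), ?_, ?_⟩
  · rw [neg_pos]
    exact Real.log_neg hm0 (max_lt hq (by norm_num))
  · rw [neg_neg, Real.exp_log hm0, ← ENNReal.ofReal_toReal hfin]
    exact ENNReal.ofReal_le_ofReal (by rw [ENNReal.ofReal_toReal hfin]; exact le_max_left _ _)

lemma mG_T2 : ∃ c0 : ℝ, 0 < c0 ∧ ∀ (n : ℕ) (Λ : ℝ),
    mG n (T2 n Λ) ≤ ENNReal.ofReal (Real.exp (Λ - c0 * n)) := by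
  obtain ⟨c0, hc0, hQ⟩ := exists_c0
  refine ⟨c0, hc0, fun n Λ => ?_⟩
  have hI : ∫⁻ G, ∏ i, fQ (G i i) ∂(mG n) ≤ ENNReal.ofReal (Real.exp (-(c0 * n))) := by
    have h1 := lintegral_pi_prod (fun _ : Fin n => Measure.pi fun _ : Fin n => complexGaussian)
      (fun i (r : Fin n → ℂ) => fQ (r i)) (fun i => measurable_fQ.comp (measurable_pi_apply i))
    rw [mG, h1]
    have h2 : ∀ i : Fin n, ∫⁻ r : Fin n → ℂ, fQ (r i) ∂(Measure.pi fun _ : Fin n => complexGaussian)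
        = ∫⁻ z, fQ z ∂complexGaussian := fun i =>
      (measurePreserving_eval (fun _ : Fin n => complexGaussian) i).lintegral_comp measurable_fQ
    simp only [h2, Finset.prod_const, Finset.card_univ, Fintype.card_fin]
    calc _ ≤ (ENNReal.ofReal (Real.exp (-c0))) ^ n := by gcongr
      _ = _ := by
        rw [← ENNReal.ofReal_pow (Real.exp_pos _).le, ← Real.exp_nat_mul]
        congr 2; ring
  have hF : ∀ G : Fin n → Fin n → ℂ, ∏ i, fQ (G i i) = ENNReal.ofReal (Real.exp (-∑ i, max (G i i).re 0)) := by
    intro G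
    rw [← Finset.sum_neg_distrib, Real.exp_sum, ENNReal.ofReal_prod_of_nonneg (fun i _ => (Real.exp_pos _).le)]
    rfl
  have hM := mul_meas_ge_le_lintegral (μ := mG n) (f := fun G => ∏ i, fQ (G i i))
    (Finset.measurable_prod _ (fun i _ => measurable_fQ.comp (by fun_prop)))
    (ENNReal.ofReal (Real.exp (-Λ)))
  have hsub : T2 n Λ ⊆ {G | ENNReal.ofReal (Real.exp (-Λ)) ≤ ∏ i, fQ (G i i)} := by
    intro G hG
    have hG' : ∑ i, max (G i i).re 0 ≤ Λ := hG
    rw [Set.mem_ofPred_eq, hF]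
    exact ENNReal.ofReal_le_ofReal (Real.exp_le_exp.2 (by linarith))
  have h3 : ENNReal.ofReal (Real.exp Λ) * ENNReal.ofReal (Real.exp (-Λ)) = 1 := by
    rw [← ENNReal.ofReal_mul (Real.exp_pos _).le, ← Real.exp_add]; simp
  calc mG n (T2 n Λ) = ENNReal.ofReal (Real.exp Λ) * (ENNReal.ofReal (Real.exp (-Λ)) * mG n (T2 n Λ)) := by
        rw [← mul_assoc, h3, one_mul]
    _ ≤ ENNReal.ofReal (Real.exp Λ) * ENNReal.ofReal (Real.exp (-(c0 * n))) := by
        gcongr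
        exact ((mul_le_mul_right (measure_mono hsub) _).trans hM).trans hI
    _ = _ := by
        rw [← ENNReal.ofReal_mul (Real.exp_pos _).le, ← Real.exp_add]; rfl

/-- Euclidean ball -/
def bl (n : ℕ) (r : ℝ) : Set (Fin n → ℂ) := {u | ∑ i, ‖u i‖ ^ 2 ≤ r ^ 2}

lemma isClosed_bl (n : ℕ) (r : ℝ) : IsClosed (bl n r) := by
  refine isClosed_le ?_ continuous_const
  fun_prop

lemma bl_finite (n : ℕ) (r : ℝ) : volume (bl n r) ≠ ⊤ := by
  have : bl n r ⊆ Metric.closedBall 0 |r| := by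
    intro u hu
    rw [mem_closedBall_zero_iff, pi_norm_le_iff_of_nonneg (abs_nonneg r)]
    intro i
    have h1 : ∑ i, ‖u i‖ ^ 2 ≤ r ^ 2 := hu
    have h2 : ‖u i‖ ^ 2 ≤ ∑ i, ‖u i‖ ^ 2 :=
      Finset.single_le_sum (f := fun i => ‖u i‖ ^ 2) (fun i _ => by positivity) (Finset.mem_univ i)
    rw [← abs_of_nonneg (norm_nonneg (u i))]
    exact sq_le_sq.1 (h2.trans h1)
  exact ne_top_of_le_ne_top (isCompact_closedBall _ _).measure_lt_top.ne (measure_mono this)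

lemma bl_pos (n : ℕ) : volume (bl n 1) ≠ 0 := by
  have ho : IsOpen {u : Fin n → ℂ | ∑ i, ‖u i‖ ^ 2 < 1} := by
    refine isOpen_lt ?_ continuous_const
    fun_prop
  have h1 := ho.measure_pos volume ⟨0, by simp⟩
  intro h
  refine h1.ne' (measure_mono_null ?_ h)
  intro u hu
  have hu' : ∑ i, ‖u i‖ ^ 2 < 1 := hu
  change ∑ i, ‖u i‖ ^ 2 ≤ 1 ^ 2
  linarith

open scoped Pointwise in
lemma bl_two (n : ℕ) : volume (bl n 2) = 4 ^ n * volume (bl n 1) := by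
  have h : bl n 2 = (2 : ℝ) • bl n 1 := by
    ext u
    rw [Set.mem_smul_set_iff_inv_smul_mem₀ (by norm_num)]
    have : ∑ i, ‖((2 : ℝ)⁻¹ • u) i‖ ^ 2 = (1 / 4) * ∑ i, ‖u i‖ ^ 2 := by
      rw [Finset.mul_sum]
      refine Finset.sum_congr rfl (fun i _ => ?_)
      rw [Pi.smul_apply, norm_smul, mul_pow]
      norm_num
    change ∑ i, ‖u i‖ ^ 2 ≤ 2 ^ 2 ↔ ∑ i, ‖((2 : ℝ)⁻¹ • u) i‖ ^ 2 ≤ 1 ^ 2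
    rw [this]
    constructor <;> intro h <;> linarith
  rw [h, Measure.addHaar_smul]
  congr 1
  rw [Module.finrank_pi_fintype]
  simp only [Complex.finrank_real_complex, Finset.sum_const, Finset.card_univ, Fintype.card_fin, smul_eq_mul]
  rw [mul_comm, pow_mul, abs_of_pos (by positivity), ENNReal.ofReal_pow (by norm_num)]
  norm_num

lemma symm_bound {n : ℕ} (l : (Fin n → ℂ) → ℝ) (hadd : ∀ a b, l (a + b) = l a + l b)
    (hneg : ∀ a, l (-a) = - l a) (hc : Continuous l) {u0 : Fin n → ℂ} (hu0 : u0 ∈ bl n 1) :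
    volume (bl n 1) * ENNReal.ofReal (Real.exp (l u0)) ≤
      ∫⁻ u in bl n 2, ENNReal.ofReal (Real.exp (l u)) := by
  set f : (Fin n → ℂ) → ENNReal := fun u => ENNReal.ofReal (Real.exp (l u)) with hf
  have hfm : Measurable f := by
    have := hc.measurable
    fun_prop
  have hm1 := (isClosed_bl n 1).measurableSet
  have hm2 := (isClosed_bl n 2).measurableSet
  have hA : ∫⁻ h, (bl n 1).indicator (fun h => f (u0 + h)) h ≤ ∫⁻ u in bl n 2, f u := by
    rw [← lintegral_indicator hm2, ← lintegral_add_left_eq_self ((bl n 2).indicator f) u0]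
    refine lintegral_mono (fun h => ?_)
    by_cases hh : h ∈ bl n 1
    · have : u0 + h ∈ bl n 2 := by
        have h1 : ∑ i, ‖u0 i‖ ^ 2 ≤ 1 ^ 2 := hu0
        have h2 : ∑ i, ‖h i‖ ^ 2 ≤ 1 ^ 2 := hh
        change ∑ i, ‖u0 i + h i‖ ^ 2 ≤ 2 ^ 2
        have h3 : ∑ i, ‖u0 i + h i‖ ^ 2 ≤ ∑ i, (2 * ‖u0 i‖ ^ 2 + 2 * ‖h i‖ ^ 2) := by
          refine Finset.sum_le_sum (fun i _ => ?_)
          have := norm_add_le (u0 i) (h i)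
          nlinarith [sq_nonneg (‖u0 i‖ - ‖h i‖), norm_nonneg (u0 i + h i)]
        rw [Finset.sum_add_distrib, ← Finset.mul_sum, ← Finset.mul_sum] at h3
        linarith
      rw [Set.indicator_of_mem hh, Set.indicator_of_mem this]
    · rw [Set.indicator_of_notMem hh]; exact zero_le
  have hA2 : ∫⁻ h, (bl n 1).indicator (fun h => f (u0 + h)) h
      = ∫⁻ h, (bl n 1).indicator (fun h => f (u0 - h)) h := by
    rw [← lintegral_neg_eq_self]
    refine lintegral_congr (fun h => ?_)
    have : -h ∈ bl n 1 ↔ h ∈ bl n 1 := by simp [bl]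
    by_cases hh : h ∈ bl n 1
    · rw [Set.indicator_of_mem hh, Set.indicator_of_mem (this.2 hh), sub_eq_add_neg]
    · rw [Set.indicator_of_notMem hh, Set.indicator_of_notMem (fun h' => hh (this.1 h'))]
  have hsum : 2 * (volume (bl n 1) * f u0) ≤ 2 * ∫⁻ h, (bl n 1).indicator (fun h => f (u0 + h)) h := by
    rw [two_mul (∫⁻ h, (bl n 1).indicator (fun h => f (u0 + h)) h)]
    nth_rewrite 2 [hA2]
    have hind : Measurable ((bl n 1).indicator (fun h => f (u0 + h))) :=
      Measurable.indicator (by fun_prop) hm1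
    rw [← lintegral_add_left hind]
    have : 2 * (volume (bl n 1) * f u0) = ∫⁻ h, (bl n 1).indicator (fun _ => 2 * f u0) h := by
      rw [lintegral_indicator hm1, setLIntegral_const]; ring
    rw [this]
    refine lintegral_mono (fun h => ?_)
    by_cases hh : h ∈ bl n 1
    · simp only [Set.indicator_of_mem hh, hf]
      rw [← ENNReal.ofReal_add (Real.exp_pos _).le (Real.exp_pos _).le,
        ← ENNReal.ofReal_ofNat 2, ← ENNReal.ofReal_mul (by norm_num)]
      refine ENNReal.ofReal_le_ofReal ?_
      rw [sub_eq_add_neg, hadd, hadd, hneg, Real.exp_add, Real.exp_add, ← mul_add, mul_comm]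
      refine mul_le_mul_of_nonneg_left ?_ (Real.exp_pos _).le
      have := Real.one_le_cosh (l h)
      rw [Real.cosh_eq] at this
      linarith
    · simp only [Set.indicator_of_notMem hh]; simp
  have h4 := (ENNReal.mul_le_mul_iff_right (by norm_num) (by norm_num)).1 hsum
  exact h4.trans hA

lemma gauss_mgf (t : ℝ) : ∫⁻ x, ENNReal.ofReal (Real.exp (t * x)) ∂(gaussianReal 0 1)
    = ENNReal.ofReal (Real.exp (t ^ 2 / 2)) := by
  rw [← ofReal_integral_eq_lintegral_ofReal (integrable_exp_mul_gaussianReal t)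
    (Filter.Eventually.of_forall (fun x => (Real.exp_pos _).le))]
  have := congrFun (mgf_id_gaussianReal (μ := 0) (v := 1)) t
  simp only [mgf, id] at this
  rw [this]
  simp

lemma cg_mgf (c : ℂ) : ∫⁻ g, ENNReal.ofReal (Real.exp ((g * c).re)) ∂complexGaussian
    = ENNReal.ofReal (Real.exp (‖c‖ ^ 2 / 2)) := by
  have hf : Measurable (fun p : ℝ × ℝ => Complex.mk p.1 p.2) := Complex.measurableEquivRealProd.symm.measurable
  rw [complexGaussian, lintegral_map (by fun_prop) hf]
  have h1 : ∀ p : ℝ × ℝ, ENNReal.ofReal (Real.exp (((Complex.mk p.1 p.2) * c).re))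
      = ENNReal.ofReal (Real.exp (c.re * p.1)) * ENNReal.ofReal (Real.exp ((-c.im) * p.2)) := by
    intro p
    rw [← ENNReal.ofReal_mul (Real.exp_pos _).le, ← Real.exp_add]
    congr 2
    simp; ring
  simp only [h1]
  rw [lintegral_prod_mul (f := fun a => ENNReal.ofReal (Real.exp (c.re * a)))
    (g := fun a => ENNReal.ofReal (Real.exp ((-c.im) * a))) (by fun_prop) (by fun_prop), gauss_mgf, gauss_mgf,
    ← ENNReal.ofReal_mul (Real.exp_pos _).le, ← Real.exp_add]
  congr 2
  rw [← Complex.normSq_eq_norm_sq, Complex.normSq_apply]; ring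

lemma mG_mgf {n : ℕ} (c : Fin n → Fin n → ℂ) :
    ∫⁻ G, ENNReal.ofReal (Real.exp (∑ i, ∑ j, (G i j * c i j).re)) ∂(mG n)
      = ENNReal.ofReal (Real.exp (∑ i, ∑ j, ‖c i j‖ ^ 2 / 2)) := by
  have h0 : ∀ f : Fin n → Fin n → ℝ, ENNReal.ofReal (Real.exp (∑ i, ∑ j, f i j))
      = ∏ i, ∏ j, ENNReal.ofReal (Real.exp (f i j)) := by
    intro f
    rw [Real.exp_sum, ENNReal.ofReal_prod_of_nonneg (fun i _ => (Real.exp_pos _).le)]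
    refine Finset.prod_congr rfl (fun i _ => ?_)
    rw [Real.exp_sum, ENNReal.ofReal_prod_of_nonneg (fun i _ => (Real.exp_pos _).le)]
  simp only [h0]
  rw [mG, lintegral_pi_prod (fun _ : Fin n => Measure.pi fun _ : Fin n => complexGaussian)
    (fun i (r : Fin n → ℂ) => ∏ j, ENNReal.ofReal (Real.exp ((r j * c i j).re))) (fun i => by fun_prop)]
  refine Finset.prod_congr rfl (fun i _ => ?_)
  rw [lintegral_pi_prod (fun _ : Fin n => complexGaussian)
    (fun j z => ENNReal.ofReal (Real.exp ((z * c i j).re))) (fun i => by fun_prop)]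
  exact Finset.prod_congr rfl (fun j _ => cg_mgf _)

noncomputable def bil {n : ℕ} (G : Fin n → Fin n → ℂ) (u w : Fin n → ℂ) : ℝ :=
  (star u ⬝ᵥ (hB G *ᵥ w)).re

noncomputable def cc {n : ℕ} (u w : Fin n → ℂ) (i j : Fin n) : ℂ :=
  (1 / 2 : ℂ) * (star (u i) * w j + u j * star (w i))

lemma bil_eq {n : ℕ} (G : Fin n → Fin n → ℂ) (u w : Fin n → ℂ) :
    bil G u w = ∑ i, ∑ j, (G i j * cc u w i j).re := by
  have h1 : bil G u w = ∑ i, ∑ j, ((1 / 2 : ℂ) * (star (u i) * G i j * w j)).re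
      + ∑ i, ∑ j, ((1 / 2 : ℂ) * (star (u i) * star (G j i) * w j)).re := by
    rw [bil, ← Finset.sum_add_distrib]
    simp only [← Finset.sum_add_distrib, dotProduct, mulVec, Finset.mul_sum, Complex.re_sum]
    refine Finset.sum_congr rfl (fun i _ => Finset.sum_congr rfl (fun j _ => ?_))
    rw [hB_apply, ← Complex.add_re, Pi.star_apply]
    congr 1; ring
  rw [h1]
  nth_rewrite 2 [Finset.sum_comm]
  rw [← Finset.sum_add_distrib]
  simp only [← Finset.sum_add_distrib]
  refine Finset.sum_congr rfl (fun i _ => Finset.sum_congr rfl (fun j _ => ?_))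
  simp [cc]
  ring

lemma cc_sum {n : ℕ} {u w : Fin n → ℂ} (hu : u ∈ bl n 2) (hw : w ∈ bl n 2) :
    ∑ i, ∑ j, ‖cc u w i j‖ ^ 2 ≤ 16 := by
  have hu' : ∑ i, ‖u i‖ ^ 2 ≤ 2 ^ 2 := hu
  have hw' : ∑ i, ‖w i‖ ^ 2 ≤ 2 ^ 2 := hw
  have h1 : ∀ i j, ‖cc u w i j‖ ^ 2 ≤ (1 / 2) * (‖u i‖ ^ 2 * ‖w j‖ ^ 2) + (1 / 2) * (‖w i‖ ^ 2 * ‖u j‖ ^ 2) := by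
    intro i j
    rw [cc, norm_mul]
    have h2 := norm_add_le (star (u i) * w j) (u j * star (w i))
    rw [norm_mul, norm_mul, norm_star, norm_star] at h2
    have h3 : ‖(1 / 2 : ℂ)‖ = 1 / 2 := by norm_num
    rw [h3]
    nlinarith [sq_nonneg (‖u i‖ * ‖w j‖ - ‖u j‖ * ‖w i‖), norm_nonneg (star (u i) * w j + u j * star (w i))]
  have h2 : ∑ i, ∑ j, ((1 / 2) * (‖u i‖ ^ 2 * ‖w j‖ ^ 2) + (1 / 2) * (‖w i‖ ^ 2 * ‖u j‖ ^ 2))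
      = (∑ i, ‖u i‖ ^ 2) * (∑ i, ‖w i‖ ^ 2) := by
    simp only [Finset.sum_add_distrib, ← Finset.mul_sum, ← Finset.sum_mul]
    ring
  have h3 : 0 ≤ ∑ i, ‖u i‖ ^ 2 := Finset.sum_nonneg (fun i _ => by positivity)
  have h4 : 0 ≤ ∑ i, ‖w i‖ ^ 2 := Finset.sum_nonneg (fun i _ => by positivity)
  calc _ ≤ _ := Finset.sum_le_sum (fun i _ => Finset.sum_le_sum (fun j _ => h1 i j))
    _ = _ := h2
    _ ≤ _ := by nlinarith

lemma exp_bil {n : ℕ} (θ : ℝ) {u w : Fin n → ℂ} (hu : u ∈ bl n 2) (hw : w ∈ bl n 2) :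
    ∫⁻ G, ENNReal.ofReal (Real.exp (θ * bil G u w)) ∂(mG n) ≤ ENNReal.ofReal (Real.exp (8 * θ ^ 2)) := by
  have h1 : ∀ G : Fin n → Fin n → ℂ, θ * bil G u w = ∑ i, ∑ j, (G i j * ((θ : ℂ) * cc u w i j)).re := by
    intro G
    rw [bil_eq]
    simp only [Finset.mul_sum]
    refine Finset.sum_congr rfl (fun i _ => Finset.sum_congr rfl (fun j _ => ?_))
    rw [mul_left_comm, Complex.re_ofReal_mul]
  simp only [h1]
  rw [mG_mgf]
  refine ENNReal.ofReal_le_ofReal (Real.exp_le_exp.2 ?_)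
  have h2 : ∑ i, ∑ j, ‖(θ : ℂ) * cc u w i j‖ ^ 2 / 2 = θ ^ 2 / 2 * ∑ i, ∑ j, ‖cc u w i j‖ ^ 2 := by
    simp only [Finset.mul_sum]
    refine Finset.sum_congr rfl (fun i _ => Finset.sum_congr rfl (fun j _ => ?_))
    rw [norm_mul, mul_pow, Complex.norm_real, Real.norm_eq_abs, sq_abs]; ring
  rw [h2]
  nlinarith [cc_sum hu hw, sq_nonneg θ]

lemma continuous_bil {n : ℕ} : Continuous
    (fun y : (Fin n → Fin n → ℂ) × ((Fin n → ℂ) × (Fin n → ℂ)) => bil y.1 y.2.1 y.2.2) := by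
  simp only [bil_eq, cc]
  fun_prop

lemma lower_bil {n : ℕ} (θ : ℝ) (G : Fin n → Fin n → ℂ) {u0 : Fin n → ℂ} (hu0 : u0 ∈ bl n 1) :
    volume (bl n 1) ^ 2 * ENNReal.ofReal (Real.exp (θ * qf (hB G) u0)) ≤
      ∫⁻ y, ENNReal.ofReal (Real.exp (θ * bil G y.1 y.2))
        ∂((volume.restrict (bl n 2)).prod (volume.restrict (bl n 2))) := by
  have hc := continuous_bil (n := n)
  have hcG : Continuous (fun y : (Fin n → ℂ) × (Fin n → ℂ) => bil G y.1 y.2) :=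
    hc.comp (f := fun y : (Fin n → ℂ) × (Fin n → ℂ) => (G, y)) (by fun_prop)
  have hm := hcG.measurable
  rw [lintegral_prod _ (by fun_prop)]
  have h1 : ∀ u : Fin n → ℂ, volume (bl n 1) * ENNReal.ofReal (Real.exp (θ * bil G u u0)) ≤
      ∫⁻ w in bl n 2, ENNReal.ofReal (Real.exp (θ * bil G u w)) := by
    intro u
    refine symm_bound (fun w => θ * bil G u w) ?_ ?_ ?_ hu0
    · intro a b
      simp only [bil, mulVec_add, dotProduct_add, Complex.add_re]; ring
    · intro a
      simp only [bil, mulVec_neg, dotProduct_neg, Complex.neg_re]; ring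
    · have : Continuous (fun w => bil G u w) :=
        hcG.comp (f := fun w : Fin n → ℂ => (u, w)) (by fun_prop)
      fun_prop
  have h2 : volume (bl n 1) * ENNReal.ofReal (Real.exp (θ * bil G u0 u0)) ≤
      ∫⁻ u in bl n 2, ENNReal.ofReal (Real.exp (θ * bil G u u0)) := by
    refine symm_bound (fun u => θ * bil G u u0) ?_ ?_ ?_ hu0
    · intro a b
      simp only [bil, star_add, add_dotProduct, Complex.add_re]; ring
    · intro a
      simp only [bil, star_neg, neg_dotProduct, Complex.neg_re]; ring
    · have : Continuous (fun w => bil G w u0) :=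
        hcG.comp (f := fun w : Fin n → ℂ => (w, u0)) (by fun_prop)
      fun_prop
  calc _ = volume (bl n 1) * (volume (bl n 1) * ENNReal.ofReal (Real.exp (θ * bil G u0 u0))) := by
        rw [sq, mul_assoc]; rfl
    _ ≤ volume (bl n 1) * ∫⁻ u in bl n 2, ENNReal.ofReal (Real.exp (θ * bil G u u0)) := by gcongr
    _ = ∫⁻ u in bl n 2, volume (bl n 1) * ENNReal.ofReal (Real.exp (θ * bil G u u0)) := by
        rw [lintegral_const_mul' _ _ (bl_finite n 1)]
    _ ≤ _ := lintegral_mono (fun u => h1 u)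

lemma mG_T1 (n : ℕ) (θ Λ : ℝ) (hθ : 0 ≤ θ) :
    mG n (T1 n Λ) ≤ ENNReal.ofReal (16 ^ n * Real.exp (8 * θ ^ 2 - θ * Λ)) := by
  set V := volume (bl n 1) with hV
  have hV0 : V ≠ 0 := bl_pos n
  have hVt : V ≠ ⊤ := bl_finite n 1
  set ν := (volume.restrict (bl n 2)).prod (volume.restrict (bl n 2)) with hν
  set F : (Fin n → Fin n → ℂ) → ENNReal :=
    fun G => ∫⁻ y, ENNReal.ofReal (Real.exp (θ * bil G y.1 y.2)) ∂ν with hF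
  have hc := (continuous_bil (n := n)).measurable
  have hFm : Measurable (fun y : (Fin n → Fin n → ℂ) × ((Fin n → ℂ) × (Fin n → ℂ)) =>
    ENNReal.ofReal (Real.exp (θ * bil y.1 y.2.1 y.2.2))) := by fun_prop
  have hνu : ν Set.univ = (4 ^ n * V) ^ 2 := by
    rw [hν, ← Set.univ_prod_univ, Measure.prod_prod, Measure.restrict_apply_univ, bl_two]; ring
  have hI : ∫⁻ G, F G ∂(mG n) ≤ ENNReal.ofReal (Real.exp (8 * θ ^ 2)) * (4 ^ n * V) ^ 2 := by
    rw [hF, lintegral_lintegral_swap hFm.aemeasurable]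
    have hae : ∀ᵐ y ∂ν, y ∈ bl n 2 ×ˢ bl n 2 := by
      rw [hν, Measure.prod_restrict]
      exact ae_restrict_mem ((isClosed_bl n 2).measurableSet.prod (isClosed_bl n 2).measurableSet)
    calc _ ≤ ∫⁻ y, ENNReal.ofReal (Real.exp (8 * θ ^ 2)) ∂ν := by
          refine lintegral_mono_ae (hae.mono (fun y hy => ?_))
          exact exp_bil θ hy.1 hy.2
      _ = _ := by rw [lintegral_const, hνu]
  have hM := mul_meas_ge_le_lintegral (μ := mG n) (f := F) hFm.lintegral_prod_right'
    (V ^ 2 * ENNReal.ofReal (Real.exp (θ * Λ)))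
  have hsub : T1 n Λ ⊆ {G | V ^ 2 * ENNReal.ofReal (Real.exp (θ * Λ)) ≤ F G} := by
    rintro G ⟨u, hu, h⟩
    have hu' : u ∈ bl n 1 := by
      have h1 : ∑ i, ‖u i‖ ^ 2 = 1 := hu
      change ∑ i, ‖u i‖ ^ 2 ≤ 1 ^ 2
      rw [h1]; norm_num
    refine le_trans ?_ (lower_bil θ G hu')
    gcongr
  have h5 : V ^ 2 * ENNReal.ofReal (Real.exp (θ * Λ)) * mG n (T1 n Λ) ≤
      V ^ 2 * ENNReal.ofReal (Real.exp (θ * Λ)) * ENNReal.ofReal (16 ^ n * Real.exp (8 * θ ^ 2 - θ * Λ)) := by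
    refine ((mul_le_mul_right (measure_mono hsub) _).trans hM).trans (hI.trans (le_of_eq ?_))
    rw [mul_assoc, ← ENNReal.ofReal_mul (Real.exp_pos _).le]
    have e1 : Real.exp (θ * Λ) * (16 ^ n * Real.exp (8 * θ ^ 2 - θ * Λ)) = 16 ^ n * Real.exp (8 * θ ^ 2) := by
      rw [mul_left_comm, ← Real.exp_add]; congr 2; ring
    rw [e1, ENNReal.ofReal_mul (by positivity), ENNReal.ofReal_pow (by norm_num), mul_pow, ← pow_mul,
      mul_comm n 2, pow_mul]
    norm_num
    ring
  refine (ENNReal.mul_le_mul_iff_right ?_ ?_).1 h5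
  · refine mul_ne_zero (pow_ne_zero _ hV0) ?_
    rw [Ne, ENNReal.ofReal_eq_zero, not_le]; exact Real.exp_pos _
  · exact ENNReal.mul_ne_top (ENNReal.pow_ne_top hVt) ENNReal.ofReal_ne_top

lemma GUE_le_one (n : ℕ) (S : Set (Matrix (Fin n) (Fin n) ℂ)) : GUE n S ≤ 1 := by
  have hmeas : Measurable (hB : (Fin n → Fin n → ℂ) → (Fin n → Fin n → ℂ)) :=
    measurable_aux _ continuous_hB
  calc GUE n S ≤ GUE n Set.univ := measure_mono (Set.subset_univ _)
    _ = mG n (hB ⁻¹' Set.univ) := Measure.map_apply hmeas MeasurableSet.univ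
    _ = 1 := by rw [Set.preimage_univ, measure_univ]

theorem main_bound :
    ∃ C c : ℝ, 0 < C ∧ 0 < c ∧
      ∀ (n : ℕ) (_ : 1 ≤ n) (x : ℝ) (_ : 1 ≤ x) (h1 : n - 1 < n) (h2 : n - 2 < n),
        GUE n {H | |sortedEigs H ⟨n - 1, h1⟩| <
            Real.exp (1 / x) * |sortedEigs H ⟨n - 2, h2⟩|} ≤
          ENNReal.ofReal (C * (n : ℝ) ^ 4 / x ^ 3 + C * Real.exp (-(c * n))) := by
  obtain ⟨c0, hc0, hT2⟩ := mG_T2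
  set c : ℝ := min 1 (c0 / 2) with hc
  have hcpos : 0 < c := lt_min one_pos (by positivity)
  have hc1 : c ≤ 1 := min_le_left _ _
  have hc2 : c ≤ c0 / 2 := min_le_right _ _
  set C : ℝ := 1 + Real.exp (72 / c0) + Real.exp (3 / 2) * 288 ^ 3 + Real.exp c with hC
  have p1 := Real.exp_pos (72 / c0)
  have p2 := Real.exp_pos (3 / 2)
  have p3 := Real.exp_pos c
  refine ⟨C, c, by positivity, hcpos, ?_⟩
  intro n hn x hx hlt1 hlt2
  have hx0 : 0 < x := by linarith
  obtain ⟨m, rfl⟩ : ∃ m, n = m + 1 := ⟨n - 1, by omega⟩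
  rcases Nat.eq_zero_or_pos m with rfl | hm
  · refine (GUE_le_one _ _).trans ?_
    rw [ENNReal.one_le_ofReal]
    have h1 : 0 ≤ C * ((0 + 1 : ℕ) : ℝ) ^ 4 / x ^ 3 := by positivity
    have h2 : Real.exp c * Real.exp (-(c * ((0 + 1 : ℕ) : ℝ))) = 1 := by
      rw [← Real.exp_add]; simp
    have h3 : Real.exp c * Real.exp (-(c * ((0 + 1 : ℕ) : ℝ))) ≤ C * Real.exp (-(c * ((0 + 1 : ℕ) : ℝ))) := by
      refine mul_le_mul_of_nonneg_right ?_ (Real.exp_pos _).le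
      rw [hC]
      have : 0 < Real.exp (3 / 2) * 288 ^ 3 := by positivity
      linarith
    rw [h2] at h3
    exact h3.trans (le_add_of_nonneg_left h1)
  · set N : ℝ := ((m + 1 : ℕ) : ℝ) with hN
    have hN1 : 1 ≤ N := by rw [hN]; exact_mod_cast Nat.succ_le_succ (Nat.zero_le m)
    set s := Real.sqrt N with hs
    have hs2 : s ^ 2 = N := Real.sq_sqrt (by linarith)
    have hs0 : 0 ≤ s := Real.sqrt_nonneg _
    have hs1 : 1 ≤ s := Real.one_le_sqrt.2 hN1
    have hb := GUE_bound (m := m) hm (by omega) (by omega) hx (Λ := 12 * s) (by linarith)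
    have e1 : mG (m + 1) (T1 (m + 1) (12 * s)) ≤ ENNReal.ofReal (Real.exp (-(c * N))) := by
      refine (mG_T1 (m + 1) s (12 * s) hs0).trans (ENNReal.ofReal_le_ofReal ?_)
      have h16 : (16 : ℝ) ≤ Real.exp 3 := by
        have := Real.exp_one_gt_d9
        have h3 : Real.exp 3 = Real.exp 1 ^ 3 := by rw [← Real.exp_nat_mul]; norm_num
        rw [h3]
        calc (16 : ℝ) ≤ 2.7 ^ 3 := by norm_num
          _ ≤ _ := by gcongr; linarith
      calc (16 : ℝ) ^ (m + 1) * Real.exp (8 * s ^ 2 - s * (12 * s))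
          ≤ Real.exp 3 ^ (m + 1) * Real.exp (8 * s ^ 2 - s * (12 * s)) := by gcongr
        _ = Real.exp (-N) := by
          rw [← Real.exp_nat_mul, ← Real.exp_add]
          congr 1
          rw [← hN]
          linear_combination (-4) * hs2
        _ ≤ _ := Real.exp_le_exp.2 (by nlinarith)
    have e2 : mG (m + 1) (T2 (m + 1) (12 * s)) ≤
        ENNReal.ofReal (Real.exp (72 / c0) * Real.exp (-(c * N))) := by
      refine (hT2 (m + 1) (12 * s)).trans (ENNReal.ofReal_le_ofReal ?_)
      rw [← Real.exp_add, Real.exp_le_exp, ← hN]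
      have h1 : 12 * s ≤ c0 / 2 * N + 72 / c0 := by
        have : 0 ≤ (c0 * s - 12) ^ 2 / (2 * c0) := by positivity
        have h2 : (c0 * s - 12) ^ 2 / (2 * c0) = c0 / 2 * s ^ 2 + 72 / c0 - 12 * s := by
          field_simp; ring
        rw [h2, hs2] at this
        linarith
      nlinarith
    have e3 : Real.exp (3 / 2) * (2 * (12 * s) / x * (12 * s)) ^ 3 ≤
        Real.exp (3 / 2) * 288 ^ 3 * (N ^ 4 / x ^ 3) := by
      have : 2 * (12 * s) / x * (12 * s) = 288 * N / x := by
        rw [← hs2]; ring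
      rw [this, div_pow, mul_pow]
      have h3 : N ^ 3 ≤ N ^ 4 := pow_le_pow_right₀ hN1 (by norm_num)
      calc _ = Real.exp (3 / 2) * 288 ^ 3 * (N ^ 3 / x ^ 3) := by ring
        _ ≤ _ := by gcongr
    calc _ ≤ _ := hb
      _ ≤ ENNReal.ofReal (Real.exp (-(c * N))) + ENNReal.ofReal (Real.exp (72 / c0) * Real.exp (-(c * N)))
          + ENNReal.ofReal (Real.exp (3 / 2) * 288 ^ 3 * (N ^ 4 / x ^ 3)) := by
        gcongr
      _ = ENNReal.ofReal (Real.exp (-(c * N)) + Real.exp (72 / c0) * Real.exp (-(c * N))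
          + Real.exp (3 / 2) * 288 ^ 3 * (N ^ 4 / x ^ 3)) := by
        rw [← ENNReal.ofReal_add (by positivity) (by positivity),
          ← ENNReal.ofReal_add (by positivity) (by positivity)]
      _ ≤ _ := by
        refine ENNReal.ofReal_le_ofReal ?_
        have q1 : 0 ≤ N ^ 4 / x ^ 3 := by positivity
        have q2 := Real.exp_pos (-(c * N))
        have r1 : Real.exp (3 / 2) * 288 ^ 3 * (N ^ 4 / x ^ 3) ≤ C * (N ^ 4 / x ^ 3) := by
          refine mul_le_mul_of_nonneg_right ?_ q1
          rw [hC]; linarith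
        have r2 : (1 + Real.exp (72 / c0)) * Real.exp (-(c * N)) ≤ C * Real.exp (-(c * N)) := by
          refine mul_le_mul_of_nonneg_right ?_ q2.le
          have : 0 < Real.exp (3 / 2) * 288 ^ 3 := by positivity
          rw [hC]; linarith
        rw [mul_div_assoc]
        linarith

end

/-- adjacent eigenvalues of GUE.  There are absolute constants
`C, c > 0` so that for all `n ≥ 1`, `x ≥ 1` and an `n × n` GUE matrix `H` with largest
and second largest eigenvalues `λ_max`, `λ_2max`:
`Prob{|λ_max| < e^{1/x}·|λ_2max|} ≤ C·n⁴/x³ + C·e^{−cn}`. -/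
theorem gue_adjacent_eigenvalue_ratio_bound :
    ∃ C c : ℝ, 0 < C ∧ 0 < c ∧
      ∀ (n : ℕ) (hn : 1 ≤ n) (x : ℝ) (hx : 1 ≤ x),
        GUE n {H | |sortedEigs H ⟨n - 1, by omega⟩| <
            Real.exp (1 / x) * |sortedEigs H ⟨n - 2, by omega⟩|} ≤
          ENNReal.ofReal (C * (n : ℝ) ^ 4 / x ^ 3 + C * Real.exp (-(c * n))) := by
  obtain ⟨C, c, hC, hc, h⟩ := main_bound
  exact ⟨C, c, hC, hc, fun n hn x hx => h n hn x hx _ _⟩
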